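/- arXiv:2511.05069 — 2 statements merged into one kernel-verified Lean document; each statement's English description precedes it below -/
import Mathlib

section
/- In the conformal renormalization framework, suppose additionally that μ is T-invariant, that θ is constant on each atom of 𝒫 with value θ_β on P_β, that R_μ : (X^θ, μ^θ) → (X^θ, μ^θ) is ergodic, and that ν is the unique ψ-conformal Borel probability measure for T with ψ constant on each atom of 𝒫 and satisfying the perfect-scaling condition ψ_A∘R⁻¹ = ψ; assume μ and ν give positive measure to every atom of 𝒫 and of 𝒫^{(1)}. Define H^u_ν := −Σ_{α∈𝒜} Σ_{0≤i<q_α} log( ν(Tⁱ(R⁻¹P_α)) / ν(P_{β(α,i)}) )·μ(Tⁱ(R⁻¹P_α))·θ_{β(α,i)}. Then H^u_ν = ρ_μ + Σ_{β∈𝒜} D(μ̄^β ‖ ν̄^β)·μ(P_β)·θ_β, where ρ_μ = −log μ(A). If moreover A ⊆ P_{α₀} for some α₀ ∈ 𝒜, T(P_α) is not contained in A for any α ∈ 𝒜, and max_{J∈𝒫^{(n)}} diam(J) → 0 as n → ∞, then μ ≠ ν implies H^u_ν > ρ_μ. -/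
open MeasureTheory Filter
open scoped ENNReal

/-- The conformal renormalization framework: a compact metric space `X`, a Borel
bijection `T` with a `φ`-conformal probability measure `μ`, a sweeping-out set `A`
with first-return time `rA`, a rescaling `R : A → X` intertwining `T` with the
first-return map and renormalizing `μ` and `φ`, a positive roof function `θ`
renormalized by the factor `e^{ρ_μ} = μ(A)⁻¹`, a finite Borel partition
`𝒫 = (P α)_{α ∈ 𝒜}` with return times `q α` on `R⁻¹ P_α ⊆ A_{q_α}` and itinerary map
`βm`, together with the refining dynamical partitions `𝒫^{(n)}` (with atoms
`Tⁱ(R⁻ⁿ P_α)`, `i < qn n α`, and atom function `Pn`). -/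
structure CRF (X : Type*) [MetricSpace X] [CompactSpace X] [MeasurableSpace X]
    [BorelSpace X] (𝒜 : Type*) [Fintype 𝒜] where
  T : X → X
  Tinv : X → X
  hT_left : Function.LeftInverse Tinv T
  hT_right : Function.RightInverse Tinv T
  hT_meas : Measurable T
  hTinv_meas : Measurable Tinv
  φ : X → ℝ
  hφ_meas : Measurable φ
  μ : Measure X
  hμ_prob : IsProbabilityMeasure μ
  hμ_conf : μ.map Tinv = μ.withDensity fun x => ENNReal.ofReal (Real.exp (φ x))
  A : Set X
  hA_meas : MeasurableSet A
  hA_cover₁ : (⋃ n : ℕ, (T^[n]) ⁻¹' A) = Set.univ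
  hA_cover₂ : (⋃ n : ℕ, (T^[n]) '' A) = Set.univ
  hμA_pos : 0 < μ A
  hμA_lt : μ A < 1
  rA : X → ℕ
  hrA_pos : ∀ x ∈ A, 1 ≤ rA x
  hrA_mem : ∀ x ∈ A, T^[rA x] x ∈ A
  hrA_min : ∀ x ∈ A, ∀ k, 1 ≤ k → k < rA x → T^[k] x ∉ A
  nA : X → ℕ
  hnA_mem : ∀ x, Tinv^[nA x] x ∈ A
  hnA_min : ∀ x, ∀ k < nA x, Tinv^[k] x ∉ A
  R : X → X
  Rinv : X → X
  hR_meas : Measurable R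
  hRinv_meas : Measurable Rinv
  hRinv_A : ∀ y, Rinv y ∈ A
  hR_Rinv : ∀ y, R (Rinv y) = y
  hRinv_R : ∀ x ∈ A, Rinv (R x) = x
  hTR : ∀ x ∈ A, T (R x) = R (T^[rA x] x)
  hφR : ∀ x ∈ A, φ (R x) = ∑ i ∈ Finset.range (rA x), φ (T^[i] x)
  hR_push : (μ.restrict A).map R = μ A • μ
  θ : X → ℝ
  hθ_meas : Measurable θ
  hθ_pos : ∀ x, 0 < θ x
  hθ_int : ∫ x, θ x ∂μ = 1
  hθA : ∀ x ∈ A,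
    (∑ i ∈ Finset.range (rA x),
        Real.exp (∑ j ∈ Finset.range i, φ (T^[j] x)) * θ (T^[i] x))
      = Real.exp (-Real.log ((μ A).toReal)) * θ (R x)
  P : 𝒜 → Set X
  hP_meas : ∀ α, MeasurableSet (P α)
  hP_disj : ∀ α β, α ≠ β → Disjoint (P α) (P β)
  hP_cover : (⋃ α, P α) = Set.univ
  q : 𝒜 → ℕ
  hq_pos : ∀ α, 1 ≤ q α
  hq_ret : ∀ α, ∀ x ∈ A, R x ∈ P α → rA x = q α
  βm : 𝒜 → ℕ → 𝒜
  hβm : ∀ α, ∀ i < q α, ∀ x ∈ A, R x ∈ P α → T^[i] x ∈ P (βm α i)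
  qn : ℕ → 𝒜 → ℕ
  hqn_pos : ∀ n, 1 ≤ n → ∀ α, 1 ≤ qn n α
  hqn_ret : ∀ n, 1 ≤ n → ∀ α, ∀ y ∈ P α,
    T^[qn n α] (Rinv^[n] y) ∈ Rinv^[n] '' Set.univ
  hqn_min : ∀ n, 1 ≤ n → ∀ α, ∀ y ∈ P α, ∀ k, 1 ≤ k → k < qn n α →
    T^[k] (Rinv^[n] y) ∉ Rinv^[n] '' Set.univ
  Pn : ℕ → X → Set X
  hPn0 : ∀ α, ∀ x ∈ P α, Pn 0 x = P α
  hPn_mem : ∀ n x, x ∈ Pn n x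
  hPn_atom : ∀ n, 1 ≤ n → ∀ α, ∀ i < qn n α,
    ∀ z ∈ (fun y => T^[i] y) '' (Rinv^[n] '' P α),
      Pn n z = (fun y => T^[i] y) '' (Rinv^[n] '' P α)
  hPn_cover : ∀ n, 1 ≤ n → ∀ z : X, ∃ α, ∃ i < qn n α,
    z ∈ (fun y => T^[i] y) '' (Rinv^[n] '' P α)

namespace CRF

variable {X : Type*} [MetricSpace X] [CompactSpace X] [MeasurableSpace X] [BorelSpace X]
variable {𝒜 : Type*} [Fintype 𝒜]

/-- `ρ_μ = -log μ(A)`. -/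
noncomputable def ρμ (F : CRF X 𝒜) : ℝ := -Real.log ((F.μ F.A).toReal)

/-- Birkhoff sums `S_n φ(x)`. -/
noncomputable def birk (F : CRF X 𝒜) (n : ℕ) (x : X) : ℝ :=
  ∑ i ∈ Finset.range n, F.φ (F.T^[i] x)

/-- Twisted Birkhoff sums `S_n^φ θ(x)`. -/
noncomputable def birkθ (F : CRF X 𝒜) (n : ℕ) (x : X) : ℝ :=
  ∑ i ∈ Finset.range n, Real.exp (F.birk i x) * F.θ (F.T^[i] x)

/-- The suspension set `X^θ = {(x,r) : 0 ≤ r < θ(x)}`. -/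
def Xθ (F : CRF X 𝒜) : Set (X × ℝ) := {p | 0 ≤ p.2 ∧ p.2 < F.θ p.1}

/-- The suspension measure `μ^θ`, the restriction of `μ ⊗ Leb` to `X^θ`. -/
noncomputable def μθ (F : CRF X 𝒜) : Measure (X × ℝ) :=
  (F.μ.prod volume).restrict F.Xθ

/-- The renormalization map `R_μ : X^θ → X^θ`,
`R_μ(x,r) = (R(T⁻ⁱ x), e^{-ρ_μ}(e^{S_i φ(T⁻ⁱ x)} r + S_i^φ θ(T⁻ⁱ x)))` with `i = n_A(x)`. -/
noncomputable def Rμ (F : CRF X 𝒜) (p : X × ℝ) : X × ℝ :=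
  (F.R (F.Tinv^[F.nA p.1] p.1),
    Real.exp (-F.ρμ) *
      (Real.exp (F.birk (F.nA p.1) (F.Tinv^[F.nA p.1] p.1)) * p.2 +
        F.birkθ (F.nA p.1) (F.Tinv^[F.nA p.1] p.1)))

/-- Ergodicity of the renormalization map `R_μ` with respect to `μ^θ`. -/
def RμErgodic (F : CRF X 𝒜) : Prop :=
  ∀ B : Set (X × ℝ), MeasurableSet B →
    F.μθ (symmDiff B (F.Rμ ⁻¹' B)) = 0 → F.μθ B = 0 ∨ F.μθ B = 1

/-- The atom `Tⁱ(R⁻¹ P_α)` of the partition `𝒫^{(1)}`. -/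
def atom1 (F : CRF X 𝒜) (α : 𝒜) (i : ℕ) : Set X :=
  (fun y => F.T^[i] y) '' (F.Rinv '' F.P α)

/-- The rescaled domain `X^{(n)} = R⁻ⁿ X`. -/
def Xdom (F : CRF X 𝒜) (n : ℕ) : Set X := F.Rinv^[n] '' Set.univ

end CRF

namespace CRF

variable {X : Type*} [MetricSpace X] [CompactSpace X] [MeasurableSpace X] [BorelSpace X]
variable {𝒜 : Type*} [Fintype 𝒜]

/-- `H^u_ν = -Σ_α Σ_{0 ≤ i < q_α} log(ν(Tⁱ R⁻¹P_α)/ν(P_{β(α,i)})) · μ(Tⁱ R⁻¹P_α) ·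
θ_{β(α,i)}`, for `θ` constant on atoms of `𝒫` with values `θv`. -/
noncomputable def HuConst (F : CRF X 𝒜) (ν : Measure X) (θv : 𝒜 → ℝ) : ℝ :=
  -∑ α : 𝒜, ∑ i ∈ Finset.range (F.q α),
    Real.log (((ν (F.atom1 α i)).toReal) / ((ν (F.P (F.βm α i))).toReal)) *
      ((F.μ (F.atom1 α i)).toReal) * θv (F.βm α i)

/-- The Kullback–Leibler divergence `D(μ̄^β ‖ ν̄^β)` of the probability vectors on
`Σ_β = {(α,i) : 0 ≤ i < q_α, β(α,i) = β}` given by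
`μ̄^β(α,i) = μ(Tⁱ R⁻¹P_α)/μ(P_β)` and `ν̄^β(α,i) = ν(Tⁱ R⁻¹P_α)/ν(P_β)`. -/
noncomputable def KLdiv [DecidableEq 𝒜] (F : CRF X 𝒜) (μ' ν' : Measure X) (β : 𝒜) : ℝ :=
  ∑ α : 𝒜, ∑ i ∈ Finset.range (F.q α),
    if F.βm α i = β then
      ((μ' (F.atom1 α i)).toReal / (μ' (F.P β)).toReal) *
        Real.log (((μ' (F.atom1 α i)).toReal / (μ' (F.P β)).toReal) /
          ((ν' (F.atom1 α i)).toReal / (ν' (F.P β)).toReal))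
    else 0

end CRF

/-- Gibbs' inequality for positive vectors of equal mass, with its equality case. -/
theorem Finset.sum_mul_log_div_nonneg {ι : Type*} (s : Finset ι) (p q : ι → ℝ)
    (hp : ∀ x ∈ s, 0 < p x) (hq : ∀ x ∈ s, 0 < q x)
    (hpq : ∑ x ∈ s, p x = ∑ x ∈ s, q x) :
    0 ≤ ∑ x ∈ s, p x * Real.log (p x / q x) ∧
      ((∃ x ∈ s, p x ≠ q x) → 0 < ∑ x ∈ s, p x * Real.log (p x / q x)) := by
  have key : ∀ x ∈ s, p x - q x ≤ p x * Real.log (p x / q x) := fun x hx => by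
    have h := Real.log_le_sub_one_of_pos (div_pos (hq x hx) (hp x hx))
    have hpx := hp x hx
    have e : Real.log (p x / q x) = -Real.log (q x / p x) := by
      rw [← Real.log_inv, inv_div]
    have h2 := mul_le_mul_of_nonneg_left h hpx.le
    have e2 : p x * (q x / p x - 1) = q x - p x := by field_simp
    rw [e]; linarith
  have h0 : ∑ x ∈ s, (p x - q x) = 0 := by rw [Finset.sum_sub_distrib, hpq, sub_self]
  refine ⟨h0 ▸ Finset.sum_le_sum key, fun ⟨x, hx, hne⟩ => ?_⟩
  refine h0 ▸ Finset.sum_lt_sum key ⟨x, hx, ?_⟩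
  have hpx := hp x hx
  have h := Real.log_lt_sub_one_of_pos (div_pos (hq x hx) hpx)
    (fun h => hne ((div_eq_one_iff_eq hpx.ne').1 h).symm)
  have e : Real.log (p x / q x) = -Real.log (q x / p x) := by
    rw [← Real.log_inv, inv_div]
  have h2 := mul_lt_mul_of_pos_left h hpx
  have e2 : p x * (q x / p x - 1) = q x - p x := by field_simp
  rw [e]; linarith

namespace CRF

variable {X : Type*} [MetricSpace X] [CompactSpace X] [MeasurableSpace X] [BorelSpace X]
variable {𝒜 : Type*} [Fintype 𝒜]

theorem image_iterate (F : CRF X 𝒜) (n : ℕ) (C : Set X) :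
    F.T^[n] '' C = F.Tinv^[n] ⁻¹' C :=
  congrFun (Set.image_eq_preimage_of_inverse (F.hT_left.iterate n) (F.hT_right.iterate n)) C

theorem image_T (F : CRF X 𝒜) (C : Set X) : F.T '' C = F.Tinv ⁻¹' C :=
  F.image_iterate 1 C

theorem image_Rinv (F : CRF X 𝒜) (B : Set X) : F.Rinv '' B = F.A ∩ F.R ⁻¹' B := by
  ext x
  constructor
  · rintro ⟨y, hy, rfl⟩
    exact ⟨F.hRinv_A y, by simpa [F.hR_Rinv] using hy⟩
  · rintro ⟨hx, hy⟩
    exact ⟨F.R x, hy, F.hRinv_R x hx⟩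

theorem measurableSet_inter_preimage_R (F : CRF X 𝒜) {B : Set X} (hB : MeasurableSet B) :
    MeasurableSet (F.A ∩ F.R ⁻¹' B) :=
  F.hA_meas.inter (F.hR_meas hB)

theorem atom1_eq (F : CRF X 𝒜) (α : 𝒜) (i : ℕ) :
    F.atom1 α i = F.T^[i] '' (F.A ∩ F.R ⁻¹' F.P α) := by
  rw [atom1, image_Rinv]

theorem measurableSet_image_iterate (F : CRF X 𝒜) (n : ℕ) {C : Set X}
    (hC : MeasurableSet C) : MeasurableSet (F.T^[n] '' C) := by
  rw [F.image_iterate]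
  exact F.hTinv_meas.iterate n hC

theorem measurableSet_atom1 (F : CRF X 𝒜) (α : 𝒜) (i : ℕ) :
    MeasurableSet (F.atom1 α i) := by
  rw [F.atom1_eq]
  exact F.measurableSet_image_iterate i (F.measurableSet_inter_preimage_R (F.hP_meas α))

theorem exists_mem_P (F : CRF X 𝒜) (x : X) : ∃ α, x ∈ F.P α :=
  Set.mem_iUnion.1 (F.hP_cover ▸ Set.mem_univ x)

theorem eq_of_mem_P (F : CRF X 𝒜) {x : X} {α β : 𝒜} (hα : x ∈ F.P α) (hβ : x ∈ F.P β) :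
    α = β := by
  by_contra h
  exact Set.disjoint_left.1 (F.hP_disj α β h) hα hβ

theorem atom1_subset (F : CRF X 𝒜) {α : 𝒜} {i : ℕ} (hi : i < F.q α) :
    F.atom1 α i ⊆ F.P (F.βm α i) := by
  rw [F.atom1_eq]
  rintro _ ⟨x, ⟨hx, hxα⟩, rfl⟩
  exact F.hβm α i hi x hx hxα

theorem exists_mem_atom1 (F : CRF X 𝒜) (x : X) : ∃ α, ∃ i < F.q α, x ∈ F.atom1 α i := by
  set y := F.Tinv^[F.nA x] x with hy
  have hyA : y ∈ F.A := F.hnA_mem x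
  obtain ⟨α, hα⟩ := F.exists_mem_P (F.R y)
  refine ⟨α, F.nA x, ?_, ?_⟩
  · by_contra! h
    rw [← F.hq_ret α y hyA hα] at h
    have h1 := F.hrA_pos y hyA
    have h2 := F.hrA_mem y hyA
    refine F.hnA_min x (F.nA x - F.rA y) (by omega) ?_
    have h3 : F.Tinv^[F.nA x] x = F.Tinv^[F.rA y] (F.Tinv^[F.nA x - F.rA y] x) := by
      rw [← Function.iterate_add_apply]; congr 2; omega
    rw [← hy] at h3
    have h4 := congrArg F.T^[F.rA y] h3
    rw [F.hT_right.iterate] at h4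
    exact h4 ▸ h2
  · rw [F.atom1_eq]
    exact ⟨y, ⟨hyA, hα⟩, F.hT_right.iterate _ x⟩

theorem succ_ne_q_of_mem_atom1 (F : CRF X 𝒜) {α : 𝒜} {i : ℕ} {x : X} (hx : x ∈ F.atom1 α i)
    (hTx : F.T x ∉ F.A) : i + 1 ≠ F.q α := by
  rintro h
  rw [F.atom1_eq] at hx
  obtain ⟨y, ⟨hy, hyα⟩, rfl⟩ := hx
  apply hTx
  rw [← Function.iterate_succ_apply' F.T, Nat.succ_eq_add_one, h, ← F.hq_ret α y hy hyα]
  exact F.hrA_mem y hy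

theorem eq_of_iterate_eq (F : CRF X 𝒜) {α : 𝒜} {i j : ℕ} {x y : X} (hx : x ∈ F.A)
    (hy : y ∈ F.A) (hyα : F.R y ∈ F.P α) (hj : j < F.q α) (hij : i ≤ j)
    (h : F.T^[i] x = F.T^[j] y) : i = j ∧ x = y := by
  have h1 : x = F.T^[j - i] y := by
    apply (F.hT_left.iterate i).injective
    rw [h, ← Function.iterate_add_apply]; congr 2; omega
  have h2 : i = j := by
    by_contra hne
    refine F.hrA_min y hy (j - i) (by omega) ?_ (h1 ▸ hx)
    rw [F.hq_ret α y hy hyα]; omega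
  subst h2
  exact ⟨rfl, by simpa using h1⟩

theorem atom1_unique (F : CRF X 𝒜) {α α' : 𝒜} {i i' : ℕ} (hi : i < F.q α) (hi' : i' < F.q α')
    {x : X} (hx : x ∈ F.atom1 α i) (hx' : x ∈ F.atom1 α' i') : α = α' ∧ i = i' := by
  rw [F.atom1_eq] at hx hx'
  obtain ⟨y, ⟨hy, hyα⟩, rfl⟩ := hx
  obtain ⟨y', ⟨hy', hyα'⟩, h⟩ := hx'
  rcases le_total i i' with hii | hii
  · obtain ⟨rfl, rfl⟩ := F.eq_of_iterate_eq hy hy' hyα' hi' hii h.symm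
    exact ⟨F.eq_of_mem_P hyα hyα', rfl⟩
  · obtain ⟨rfl, rfl⟩ := F.eq_of_iterate_eq hy' hy hyα hi hii h
    exact ⟨F.eq_of_mem_P hyα hyα', rfl⟩

/-- The index set of the partition `𝒫^{(1)}`. -/
def idx (F : CRF X 𝒜) : Finset (Σ _ : 𝒜, ℕ) :=
  Finset.univ.sigma fun α => Finset.range (F.q α)

theorem mem_idx (F : CRF X 𝒜) {p : Σ _ : 𝒜, ℕ} : p ∈ F.idx ↔ p.2 < F.q p.1 := by
  simp [idx]

theorem sum_idx (F : CRF X 𝒜) (f : 𝒜 → ℕ → ℝ) :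
    ∑ p ∈ F.idx, f p.1 p.2 = ∑ α, ∑ i ∈ Finset.range (F.q α), f α i := by
  rw [idx, Finset.sum_sigma]

theorem sum_atom1 [DecidableEq 𝒜] (F : CRF X 𝒜) (ν : Measure X) [IsFiniteMeasure ν] (β : 𝒜) :
    ∑ p ∈ F.idx with F.βm p.1 p.2 = β, ν.real (F.atom1 p.1 p.2) = ν.real (F.P β) := by
  rw [← measureReal_biUnion_finset]
  · congr 1
    ext x
    simp only [Finset.mem_filter, Set.mem_iUnion, mem_idx]
    constructor
    · rintro ⟨p, ⟨hp, rfl⟩, hx⟩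
      exact F.atom1_subset hp hx
    · intro hx
      obtain ⟨α, i, hi, hxi⟩ := F.exists_mem_atom1 x
      exact ⟨⟨α, i⟩, ⟨hi, F.eq_of_mem_P (F.atom1_subset hi hxi) hx⟩, hxi⟩
  · intro p hp p' hp' hne
    refine Set.disjoint_left.2 fun x hx hx' => hne ?_
    simp only [Finset.coe_filter, Set.mem_ofPred_eq, mem_idx] at hp hp'
    obtain ⟨h1, h2⟩ := F.atom1_unique hp.1 hp'.1 hx hx'
    cases p; cases p'; simp_all
  · exact fun p _ => F.measurableSet_atom1 _ _

theorem KLdiv_eq_sum_idx [DecidableEq 𝒜] (F : CRF X 𝒜) (μ' ν' : Measure X) (β : 𝒜) :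
    F.KLdiv μ' ν' β = ∑ p ∈ F.idx with F.βm p.1 p.2 = β,
      (μ'.real (F.atom1 p.1 p.2) / μ'.real (F.P β)) *
        Real.log ((μ'.real (F.atom1 p.1 p.2) / μ'.real (F.P β)) /
          (ν'.real (F.atom1 p.1 p.2) / ν'.real (F.P β))) := by
  rw [Finset.sum_filter]
  exact (F.sum_idx _).symm

theorem KLdiv_nonneg_and_pos [DecidableEq 𝒜] (F : CRF X 𝒜) (μ' ν' : Measure X)
    [IsFiniteMeasure μ'] [IsFiniteMeasure ν'] (β : 𝒜)
    (hμP : 0 < μ'.real (F.P β)) (hνP : 0 < ν'.real (F.P β))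
    (hμ : ∀ p ∈ F.idx, 0 < μ'.real (F.atom1 p.1 p.2))
    (hν : ∀ p ∈ F.idx, 0 < ν'.real (F.atom1 p.1 p.2)) :
    0 ≤ F.KLdiv μ' ν' β ∧
      ((∃ p ∈ F.idx, F.βm p.1 p.2 = β ∧ μ'.real (F.atom1 p.1 p.2) / μ'.real (F.P β) ≠
        ν'.real (F.atom1 p.1 p.2) / ν'.real (F.P β)) → 0 < F.KLdiv μ' ν' β) := by
  rw [F.KLdiv_eq_sum_idx]
  have h := Finset.sum_mul_log_div_nonneg (F.idx.filter fun p => F.βm p.1 p.2 = β)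
    (fun p => μ'.real (F.atom1 p.1 p.2) / μ'.real (F.P β))
    (fun p => ν'.real (F.atom1 p.1 p.2) / ν'.real (F.P β))
    (fun p hp => div_pos (hμ p (Finset.mem_filter.1 hp).1) hμP)
    (fun p hp => div_pos (hν p (Finset.mem_filter.1 hp).1) hνP)
    (by rw [← Finset.sum_div, ← Finset.sum_div, F.sum_atom1, F.sum_atom1,
      div_self hμP.ne', div_self hνP.ne'])
  refine ⟨h.1, fun ⟨p, hp, hpβ, hne⟩ => h.2 ⟨p, Finset.mem_filter.2 ⟨hp, hpβ⟩, hne⟩⟩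

/-- A measure is conformal with weights `c` when `T` scales it by `exp (c α)` on `P α`. -/
def IsConformalOnAtoms (F : CRF X 𝒜) (ν : Measure X) (c : 𝒜 → ℝ) : Prop :=
  ∀ α, ∀ C ⊆ F.P α, MeasurableSet C → ν (F.T '' C) = ENNReal.ofReal (Real.exp (c α)) * ν C

theorem withDensity_apply_of_subset (F : CRF X 𝒜) {ν : Measure X} {ψ : X → ℝ} {c : 𝒜 → ℝ}
    (hψ : ∀ α, ∀ x ∈ F.P α, ψ x = c α) {α : 𝒜} {C : Set X} (hCα : C ⊆ F.P α)
    (hC : MeasurableSet C) :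
    (ν.withDensity fun x => ENNReal.ofReal (Real.exp (ψ x))) C =
      ENNReal.ofReal (Real.exp (c α)) * ν C := by
  rw [withDensity_apply _ hC, setLIntegral_congr_fun hC
    (g := fun _ => ENNReal.ofReal (Real.exp (c α))) (fun x hx => by simp only [hψ α x (hCα hx)]),
    setLIntegral_const]

theorem isConformalOnAtoms_iff (F : CRF X 𝒜) {ν : Measure X} {ψ : X → ℝ} {c : 𝒜 → ℝ}
    (hψ : ∀ α, ∀ x ∈ F.P α, ψ x = c α) :
    F.IsConformalOnAtoms ν c ↔
      ν.map F.Tinv = ν.withDensity fun x => ENNReal.ofReal (Real.exp (ψ x)) := by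
  constructor
  · intro h
    rw [Measure.ext_iff_of_iUnion_eq_univ F.hP_cover]
    intro α
    ext B hB
    have hBα := hB.inter (F.hP_meas α)
    rw [Measure.restrict_apply hB, Measure.restrict_apply hB,
      F.withDensity_apply_of_subset hψ Set.inter_subset_right hBα,
      ← h α _ Set.inter_subset_right hBα, Measure.map_apply F.hTinv_meas hBα, F.image_T]
  · intro h α C hCα hC
    rw [← F.withDensity_apply_of_subset hψ hCα hC, ← h, Measure.map_apply F.hTinv_meas hC,
      F.image_T]

theorem IsConformalOnAtoms.measure_image_iterate {F : CRF X 𝒜} {ν : Measure X} {c : 𝒜 → ℝ}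
    (h : F.IsConformalOnAtoms ν c) {α : 𝒜} {C : Set X} (hCα : C ⊆ F.A ∩ F.R ⁻¹' F.P α)
    (hC : MeasurableSet C) {i : ℕ} (hi : i ≤ F.q α) :
    ν (F.T^[i] '' C) =
      ENNReal.ofReal (Real.exp (∑ j ∈ Finset.range i, c (F.βm α j))) * ν C := by
  induction i with
  | zero => simp
  | succ i ih =>
    have hsub : F.T^[i] '' C ⊆ F.P (F.βm α i) := by
      rintro _ ⟨x, hx, rfl⟩
      exact F.hβm α i hi x (hCα hx).1 (hCα hx).2
    rw [Function.iterate_succ', Set.image_comp,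
      h _ _ hsub (F.measurableSet_image_iterate i hC), ih (by omega), Finset.sum_range_succ,
      Real.exp_add, mul_comm (Real.exp _), ENNReal.ofReal_mul (Real.exp_pos _).le, mul_assoc]

theorem preimage_R_image_T (F : CRF X 𝒜) {α : 𝒜} {B : Set X} (hB : B ⊆ F.P α) :
    F.A ∩ F.R ⁻¹' (F.T '' B) = F.T^[F.q α] '' (F.A ∩ F.R ⁻¹' B) := by
  ext x
  constructor
  · rintro ⟨hx, b, hb, hbx⟩
    have hR := F.hR_Rinv b
    have hA := F.hRinv_A b
    have hq := F.hq_ret α _ hA (hR.symm ▸ hB hb)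
    refine ⟨F.Rinv b, ⟨hA, by simpa [hR] using hb⟩, ?_⟩
    have h1 := F.hTR _ hA
    rw [hR, hbx, hq] at h1
    rw [← F.hRinv_R x hx, h1, F.hRinv_R _ (hq ▸ F.hrA_mem _ hA)]
  · rintro ⟨y, ⟨hy, hyB⟩, rfl⟩
    rw [← F.hq_ret α y hy (hB hyB)]
    exact ⟨F.hrA_mem y hy, F.R y, hyB, F.hTR y hy⟩

/-- Uniqueness of the conformal measure together with perfect scaling of its weights forces
`R` to renormalize it. -/
theorem IsConformalOnAtoms.measure_preimage_R {F : CRF X 𝒜} {ν : Measure X}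
    [IsProbabilityMeasure ν] {c : 𝒜 → ℝ} (h : F.IsConformalOnAtoms ν c) (hA : ν F.A ≠ 0)
    (hscale : ∀ α, ∑ j ∈ Finset.range (F.q α), c (F.βm α j) = c α)
    (huniq : ∀ ν' : Measure X, IsProbabilityMeasure ν' → F.IsConformalOnAtoms ν' c → ν' = ν)
    {B : Set X} (hB : MeasurableSet B) : ν (F.A ∩ F.R ⁻¹' B) = ν F.A * ν B := by
  set ν' : Measure X := (ν F.A)⁻¹ • (ν.restrict F.A).map F.R with hν'
  have happ : ∀ B, MeasurableSet B → ν' B = (ν F.A)⁻¹ * ν (F.A ∩ F.R ⁻¹' B) := fun B hB => by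
    rw [hν', Measure.smul_apply, smul_eq_mul, Measure.map_apply F.hR_meas hB,
      Measure.restrict_apply (F.hR_meas hB), Set.inter_comm]
  have hprob : IsProbabilityMeasure ν' := ⟨by
    rw [happ _ MeasurableSet.univ, Set.preimage_univ, Set.inter_univ,
      ENNReal.inv_mul_cancel hA (measure_ne_top _ _)]⟩
  have hconf : F.IsConformalOnAtoms ν' c := by
    intro α C hCα hC
    have hTC : MeasurableSet (F.T '' C) := F.measurableSet_image_iterate 1 hC
    rw [happ _ hTC, happ _ hC, F.preimage_R_image_T hCα,
      h.measure_image_iterate (Set.inter_subset_inter_right _ (Set.preimage_mono hCα))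
        (F.measurableSet_inter_preimage_R hC) le_rfl, hscale, mul_left_comm]
  rw [← huniq ν' hprob hconf, happ _ hB, huniq ν' hprob hconf, ← mul_assoc,
    ENNReal.mul_inv_cancel hA (measure_ne_top _ _), one_mul]

theorem isConformalOnAtoms_zero (F : CRF X 𝒜) (hμinv : F.μ.map F.T = F.μ) :
    F.IsConformalOnAtoms F.μ 0 := by
  intro α C _ hC
  have hTC : MeasurableSet (F.T '' C) := F.measurableSet_image_iterate 1 hC
  nth_rw 1 [← hμinv]
  rw [Measure.map_apply F.hT_meas hTC, Set.preimage_image_eq _ F.hT_left.injective]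
  simp

theorem ae_φ_eq_zero (F : CRF X 𝒜) (hμinv : F.μ.map F.T = F.μ) :
    ∀ᵐ x ∂F.μ, ∀ j, F.φ (F.T^[j] x) = 0 := by
  have := F.hμ_prob
  have h1 : F.μ.map F.Tinv = F.μ.withDensity fun _ => 1 := by
    rw [← Pi.one_def, withDensity_one]
    nth_rw 1 [← hμinv]
    rw [Measure.map_map F.hTinv_meas F.hT_meas, F.hT_left.comp_eq_id, Measure.map_id]
  have h2 : ∀ᵐ x ∂F.μ, F.φ x = 0 := by
    have h3 := (withDensity_eq_iff_of_sigmaFinite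
      (ENNReal.measurable_ofReal.comp (Real.measurable_exp.comp F.hφ_meas)).aemeasurable
      measurable_const.aemeasurable).1 (F.hμ_conf.symm.trans h1)
    filter_upwards [h3] with x hx
    simpa using hx
  have hT : MeasurePreserving F.T F.μ F.μ := ⟨F.hT_meas, hμinv⟩
  exact ae_all_iff.2 fun j => (hT.iterate j).quasiMeasurePreserving.ae h2

theorem measure_inter_preimage_R (F : CRF X 𝒜) {B : Set X} (hB : MeasurableSet B) :
    F.μ (F.A ∩ F.R ⁻¹' B) = F.μ F.A * F.μ B := by
  have := congrArg (fun m : Measure X => m B) F.hR_push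
  simpa [Measure.map_apply F.hR_meas hB, Measure.restrict_apply (F.hR_meas hB),
    Set.inter_comm] using this

theorem measureReal_atom1 (F : CRF X 𝒜) (hμinv : F.μ.map F.T = F.μ) {α : 𝒜} {i : ℕ}
    (hi : i < F.q α) : F.μ.real (F.atom1 α i) = F.μ.real F.A * F.μ.real (F.P α) := by
  rw [measureReal_def, F.atom1_eq, (F.isConformalOnAtoms_zero hμinv).measure_image_iterate
    subset_rfl (F.measurableSet_inter_preimage_R (F.hP_meas α)) hi.le,
    F.measure_inter_preimage_R (F.hP_meas α)]
  simp [measureReal_def]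

theorem sum_θ_eq (F : CRF X 𝒜) (hμinv : F.μ.map F.T = F.μ) {θv : 𝒜 → ℝ}
    (hθv : ∀ β : 𝒜, ∀ x ∈ F.P β, F.θ x = θv β) {α : 𝒜} (hα : 0 < F.μ (F.P α)) :
    F.μ.real F.A * ∑ i ∈ Finset.range (F.q α), θv (F.βm α i) = θv α := by
  have := F.hμ_prob
  obtain ⟨x, ⟨hxA, hxα⟩, hx⟩ := Measure.exists_mem_of_measure_ne_zero_of_ae
    (μ := F.μ) (s := F.A ∩ F.R ⁻¹' F.P α) (p := fun x => ∀ j, F.φ (F.T^[j] x) = 0)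
    (by rw [F.measure_inter_preimage_R (F.hP_meas α)]; exact mul_ne_zero F.hμA_pos.ne' hα.ne')
    (ae_restrict_of_ae (F.ae_φ_eq_zero hμinv))
  have ha : 0 < F.μ.real F.A := ENNReal.toReal_pos F.hμA_pos.ne' (measure_ne_top _ _)
  have h := F.hθA x hxA
  rw [F.hq_ret α x hxA hxα, hθv α _ hxα, Real.exp_neg, ← measureReal_def, Real.exp_log ha] at h
  simp only [hx, Finset.sum_const_zero, Real.exp_zero, one_mul] at h
  rw [Finset.sum_congr rfl fun i hi =>
    hθv _ _ (F.hβm α i (Finset.mem_range.1 hi) x hxA hxα)] at h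
  rw [h, mul_inv_cancel_left₀ ha.ne']

theorem sum_measureReal_mul_θ (F : CRF X 𝒜) {θv : 𝒜 → ℝ}
    (hθv : ∀ β : 𝒜, ∀ x ∈ F.P β, F.θ x = θv β) :
    ∑ β, F.μ.real (F.P β) * θv β = 1 := by
  have hint : Integrable F.θ F.μ := by
    by_contra h
    exact zero_ne_one ((integral_undef h).symm.trans F.hθ_int)
  rw [← F.hθ_int, ← setIntegral_univ, ← F.hP_cover,
    integral_iUnion_fintype F.hP_meas (fun α β h => F.hP_disj α β h)
      (fun α => hint.integrableOn)]
  refine Finset.sum_congr rfl fun β _ => ?_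
  rw [setIntegral_congr_fun (F.hP_meas β) (hθv β), setIntegral_const, smul_eq_mul]

theorem sum_idx_mul_fiber [DecidableEq 𝒜] (F : CRF X 𝒜) (ν : Measure X) [IsFiniteMeasure ν]
    (g : 𝒜 → ℝ) :
    ∑ p ∈ F.idx, ν.real (F.atom1 p.1 p.2) * g (F.βm p.1 p.2) =
      ∑ β, ν.real (F.P β) * g β := by
  rw [← Finset.sum_fiberwise F.idx (fun p => F.βm p.1 p.2)]
  refine Finset.sum_congr rfl fun β _ => ?_
  rw [← F.sum_atom1 ν β, Finset.sum_mul]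
  refine Finset.sum_congr rfl fun p hp => ?_
  rw [(Finset.mem_filter.1 hp).2]

theorem sum_idx_mul_base (F : CRF X 𝒜) (hμinv : F.μ.map F.T = F.μ) {θv : 𝒜 → ℝ}
    (hθv : ∀ β : 𝒜, ∀ x ∈ F.P β, F.θ x = θv β) (hμP : ∀ α : 𝒜, 0 < F.μ (F.P α))
    (g : 𝒜 → ℝ) :
    ∑ p ∈ F.idx, F.μ.real (F.atom1 p.1 p.2) * (θv (F.βm p.1 p.2) * g p.1) =
      ∑ α, F.μ.real (F.P α) * (θv α * g α) := by
  rw [F.sum_idx fun α i => F.μ.real (F.atom1 α i) * (θv (F.βm α i) * g α)]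
  refine Finset.sum_congr rfl fun α _ => ?_
  rw [Finset.sum_congr rfl fun i hi => by
    rw [F.measureReal_atom1 hμinv (Finset.mem_range.1 hi)], ← Finset.mul_sum, ← Finset.sum_mul,
    ← F.sum_θ_eq hμinv hθv (hμP α)]
  ring

theorem HuConst_eq [DecidableEq 𝒜] (F : CRF X 𝒜) (hμinv : F.μ.map F.T = F.μ) {θv : 𝒜 → ℝ}
    (hθv : ∀ β : 𝒜, ∀ x ∈ F.P β, F.θ x = θv β) {ν : Measure X}
    (hμP : ∀ α : 𝒜, 0 < F.μ (F.P α)) (hνP : ∀ α : 𝒜, 0 < ν.real (F.P α))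
    (hν : ∀ p ∈ F.idx, 0 < ν.real (F.atom1 p.1 p.2)) :
    F.HuConst ν θv = F.ρμ + ∑ β, F.KLdiv F.μ ν β * F.μ.real (F.P β) * θv β := by
  have := F.hμ_prob
  have ha : 0 < F.μ.real F.A := ENNReal.toReal_pos F.hμA_pos.ne' (measure_ne_top _ _)
  have hM : ∀ α, 0 < F.μ.real (F.P α) := fun α =>
    ENNReal.toReal_pos (hμP α).ne' (measure_ne_top _ _)
  have hHu : F.HuConst ν θv = -∑ p ∈ F.idx,
      Real.log (ν.real (F.atom1 p.1 p.2) / ν.real (F.P (F.βm p.1 p.2))) *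
        F.μ.real (F.atom1 p.1 p.2) * θv (F.βm p.1 p.2) :=
    congrArg Neg.neg (F.sum_idx _).symm
  have hKL : ∑ β, F.KLdiv F.μ ν β * F.μ.real (F.P β) * θv β =
      ∑ p ∈ F.idx, F.μ.real (F.atom1 p.1 p.2) * θv (F.βm p.1 p.2) *
        Real.log ((F.μ.real (F.atom1 p.1 p.2) / F.μ.real (F.P (F.βm p.1 p.2))) /
          (ν.real (F.atom1 p.1 p.2) / ν.real (F.P (F.βm p.1 p.2)))) := by
    rw [← Finset.sum_fiberwise F.idx (fun p => F.βm p.1 p.2)]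
    refine Finset.sum_congr rfl fun β _ => ?_
    rw [F.KLdiv_eq_sum_idx, Finset.sum_mul, Finset.sum_mul]
    refine Finset.sum_congr rfl fun p hp => ?_
    rw [(Finset.mem_filter.1 hp).2]
    have := (hM β).ne'
    field_simp
  have hterm : ∀ p ∈ F.idx, F.μ.real (F.atom1 p.1 p.2) * θv (F.βm p.1 p.2) *
        Real.log ((F.μ.real (F.atom1 p.1 p.2) / F.μ.real (F.P (F.βm p.1 p.2))) /
          (ν.real (F.atom1 p.1 p.2) / ν.real (F.P (F.βm p.1 p.2)))) =
      F.μ.real (F.atom1 p.1 p.2) * θv (F.βm p.1 p.2) * Real.log (F.μ.real F.A) +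
      F.μ.real (F.atom1 p.1 p.2) * (θv (F.βm p.1 p.2) * Real.log (F.μ.real (F.P p.1))) -
      F.μ.real (F.atom1 p.1 p.2) *
        (θv (F.βm p.1 p.2) * Real.log (F.μ.real (F.P (F.βm p.1 p.2)))) -
      Real.log (ν.real (F.atom1 p.1 p.2) / ν.real (F.P (F.βm p.1 p.2))) *
        F.μ.real (F.atom1 p.1 p.2) * θv (F.βm p.1 p.2) := fun p hp => by
    have hm := F.measureReal_atom1 hμinv (F.mem_idx.1 hp)
    have hm0 : 0 < F.μ.real (F.atom1 p.1 p.2) := hm ▸ mul_pos ha (hM _)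
    rw [Real.log_div (div_pos hm0 (hM _)).ne' (div_pos (hν p hp) (hνP _)).ne',
      Real.log_div hm0.ne' (hM _).ne']
    nth_rw 2 [hm]
    rw [Real.log_mul ha.ne' (hM _).ne']
    ring
  rw [hKL, Finset.sum_congr rfl hterm, Finset.sum_sub_distrib, Finset.sum_sub_distrib,
    Finset.sum_add_distrib, ← Finset.sum_mul, F.sum_idx_mul_fiber F.μ θv,
    F.sum_measureReal_mul_θ hθv,
    F.sum_idx_mul_base hμinv hθv hμP (fun α => Real.log (F.μ.real (F.P α))),
    F.sum_idx_mul_fiber F.μ (fun β => θv β * Real.log (F.μ.real (F.P β))), hHu, ρμ,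
    ← measureReal_def]
  ring

theorem sum_measureReal_P (F : CRF X 𝒜) (ν : Measure X) [IsProbabilityMeasure ν] :
    ∑ α, ν.real (F.P α) = 1 := by
  rw [← measureReal_iUnion_fintype (fun α β h => F.hP_disj α β h) F.hP_meas, F.hP_cover,
    probReal_univ]

/-- If the conditional probabilities of `𝒫^{(1)}` given `𝒫` agree for `μ` and `ν`, then the
conformal weights of `ν` vanish. -/
theorem weights_eq_zero (F : CRF X 𝒜) (hμinv : F.μ.map F.T = F.μ) {ν : Measure X}
    [IsProbabilityMeasure ν] {c : 𝒜 → ℝ} (hc : F.IsConformalOnAtoms ν c) (hA : ν F.A ≠ 0)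
    (hμP : ∀ α : 𝒜, 0 < F.μ (F.P α)) (hνP : ∀ α : 𝒜, 0 < ν.real (F.P α))
    (hR : ∀ α, ν (F.A ∩ F.R ⁻¹' F.P α) = ν F.A * ν (F.P α))
    {α₀ : 𝒜} (hα₀ : F.A ⊆ F.P α₀) (hT : ∀ α : 𝒜, ¬ (F.T '' F.P α ⊆ F.A))
    (heq : ∀ p ∈ F.idx, F.μ.real (F.atom1 p.1 p.2) / F.μ.real (F.P (F.βm p.1 p.2)) =
      ν.real (F.atom1 p.1 p.2) / ν.real (F.P (F.βm p.1 p.2))) : c = 0 := by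
  have := F.hμ_prob
  have ha : 0 < F.μ.real F.A := ENNReal.toReal_pos F.hμA_pos.ne' (measure_ne_top _ _)
  have hb : 0 < ν.real F.A := ENNReal.toReal_pos hA (measure_ne_top _ _)
  have hM : ∀ α, 0 < F.μ.real (F.P α) := fun α =>
    ENNReal.toReal_pos (hμP α).ne' (measure_ne_top _ _)
  have hνatom : ∀ α, ∀ i < F.q α, ν.real (F.atom1 α i) =
      Real.exp (∑ j ∈ Finset.range i, c (F.βm α j)) * (ν.real F.A * ν.real (F.P α)) := by
    intro α i hi
    rw [measureReal_def, F.atom1_eq, hc.measure_image_iterate subset_rfl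
      (F.measurableSet_inter_preimage_R (F.hP_meas α)) hi.le, hR, ENNReal.toReal_mul,
      ENNReal.toReal_mul, ENNReal.toReal_ofReal (Real.exp_pos _).le]
    rfl
  have heq' : ∀ α, ∀ i < F.q α,
      F.μ.real F.A * F.μ.real (F.P α) / F.μ.real (F.P (F.βm α i)) =
        Real.exp (∑ j ∈ Finset.range i, c (F.βm α j)) * (ν.real F.A * ν.real (F.P α)) /
          ν.real (F.P (F.βm α i)) := fun α i hi => by
    rw [← F.measureReal_atom1 hμinv hi, ← hνatom α i hi]
    exact heq ⟨α, i⟩ (F.mem_idx.2 hi)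
  have hβ0 : ∀ α, F.βm α 0 = α₀ := fun α => by
    obtain ⟨y, hy⟩ := nonempty_of_measure_ne_zero (hμP α).ne'
    exact F.eq_of_mem_P (F.hβm α 0 (F.hq_pos α) (F.Rinv y) (F.hRinv_A y)
      ((F.hR_Rinv y).symm ▸ hy)) (hα₀ (F.hRinv_A y))
  have h0 : ∀ α, F.μ.real F.A / F.μ.real (F.P α₀) * F.μ.real (F.P α) =
      ν.real F.A / ν.real (F.P α₀) * ν.real (F.P α) := fun α => by
    have h := heq' α 0 (F.hq_pos α)
    rw [hβ0, Finset.sum_range_zero, Real.exp_zero, one_mul] at h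
    rw [div_mul_eq_mul_div, h, div_mul_eq_mul_div]
  have hratio : F.μ.real F.A / F.μ.real (F.P α₀) = ν.real F.A / ν.real (F.P α₀) := by
    have h := Finset.sum_congr (rfl : Finset.univ = Finset.univ) fun α _ => h0 α
    rwa [← Finset.mul_sum, ← Finset.mul_sum, F.sum_measureReal_P, F.sum_measureReal_P, mul_one,
      mul_one] at h
  have hP : ∀ α, F.μ.real (F.P α) = ν.real (F.P α) := fun α => by
    have h := h0 α
    rw [hratio] at h
    exact mul_left_cancel₀ (div_pos hb (hνP _)).ne' h
  have hab : F.μ.real F.A = ν.real F.A := by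
    rw [hP] at hratio
    exact (div_left_inj' (hνP _).ne').1 hratio
  have hsum : ∀ α, ∀ i < F.q α, ∑ j ∈ Finset.range i, c (F.βm α j) = 0 := fun α i hi => by
    have h := (div_left_inj' (hνP _).ne').1 (hP (F.βm α i) ▸ heq' α i hi)
    rw [hab, hP α] at h
    exact Real.exp_eq_one_iff _ |>.1
      (mul_right_cancel₀ (mul_pos hb (hνP α)).ne' (h.symm.trans (one_mul _).symm))
  funext γ
  obtain ⟨_, ⟨x, hx, rfl⟩, hTx⟩ := Set.not_subset.1 (hT γ)
  obtain ⟨α, i, hi, hxi⟩ := F.exists_mem_atom1 x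
  have hi' : i + 1 < F.q α := by
    have := F.succ_ne_q_of_mem_atom1 hxi hTx
    omega
  have h := hsum α (i + 1) hi'
  rw [Finset.sum_range_succ, hsum α i hi, zero_add,
    F.eq_of_mem_P (F.atom1_subset hi hxi) hx] at h
  exact h

end CRF

/-- Perfectly scaled renormalizations: if `μ` is `T`-invariant, `θ` is constant on the
atoms of `𝒫`, `R_μ` is ergodic and `ν` is the unique `ψ`-conformal measure with `ψ`
constant on atoms and perfectly scaled, then
`H^u_ν = ρ_μ + Σ_β D(μ̄^β ‖ ν̄^β) μ(P_β) θ_β`; if moreover `A ⊆ P_{α₀}`, no `T(P_α)` is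
contained in `A`, and the diameters of the partitions `𝒫^{(n)}` tend to `0`, then
`μ ≠ ν` implies `H^u_ν > ρ_μ`. -/
theorem Hu_eq_rho_add_KL
    {X : Type*} [MetricSpace X] [CompactSpace X] [MeasurableSpace X] [BorelSpace X]
    {𝒜 : Type*} [Fintype 𝒜] [DecidableEq 𝒜]
    (F : CRF X 𝒜)
    (hμinv : F.μ.map F.T = F.μ)
    (θv : 𝒜 → ℝ) (hθv : ∀ β : 𝒜, ∀ x ∈ F.P β, F.θ x = θv β)
    (herg : F.RμErgodic)
    (ψ : X → ℝ) (ν : Measure X) (hνprob : IsProbabilityMeasure ν)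
    (hνconf : ν.map F.Tinv = ν.withDensity fun x => ENNReal.ofReal (Real.exp (ψ x)))
    (hψconst : ∀ α : 𝒜, ∀ x ∈ F.P α, ∀ y ∈ F.P α, ψ x = ψ y)
    (hψscale : ∀ x ∈ F.A, (∑ i ∈ Finset.range (F.rA x), ψ (F.T^[i] x)) = ψ (F.R x))
    (hνuniq : ∀ ν' : Measure X, IsProbabilityMeasure ν' →
      ν'.map F.Tinv = ν'.withDensity (fun x => ENNReal.ofReal (Real.exp (ψ x))) → ν' = ν)
    (hμP : ∀ α : 𝒜, 0 < F.μ (F.P α)) (hνP : ∀ α : 𝒜, 0 < ν (F.P α))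
    (hμP1 : ∀ α : 𝒜, ∀ i < F.q α, 0 < F.μ (F.atom1 α i))
    (hνP1 : ∀ α : 𝒜, ∀ i < F.q α, 0 < ν (F.atom1 α i)) :
    F.HuConst ν θv
      = F.ρμ + ∑ β : 𝒜, F.KLdiv F.μ ν β * ((F.μ (F.P β)).toReal) * θv β ∧
    ((∃ α₀ : 𝒜, F.A ⊆ F.P α₀) →
      (∀ α : 𝒜, ¬ (F.T '' F.P α ⊆ F.A)) →
      (∀ ε > (0 : ℝ), ∃ N : ℕ, ∀ n ≥ N, ∀ x : X, Metric.diam (F.Pn n x) < ε) →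
      F.μ ≠ ν → F.ρμ < F.HuConst ν θv) := by
  have := F.hμ_prob
  have hM : ∀ α, 0 < F.μ.real (F.P α) := fun α =>
    ENNReal.toReal_pos (hμP α).ne' (measure_ne_top _ _)
  have hN : ∀ α, 0 < ν.real (F.P α) := fun α =>
    ENNReal.toReal_pos (hνP α).ne' (measure_ne_top _ _)
  have hm : ∀ p ∈ F.idx, 0 < F.μ.real (F.atom1 p.1 p.2) := fun p hp =>
    ENNReal.toReal_pos (hμP1 _ _ (F.mem_idx.1 hp)).ne' (measure_ne_top _ _)
  have hn : ∀ p ∈ F.idx, 0 < ν.real (F.atom1 p.1 p.2) := fun p hp =>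
    ENNReal.toReal_pos (hνP1 _ _ (F.mem_idx.1 hp)).ne' (measure_ne_top _ _)
  have hHu := F.HuConst_eq hμinv hθv hμP hN hn
  refine ⟨hHu, ?_⟩
  rintro ⟨α₀, hα₀⟩ hT - hne
  have hKL := fun β => F.KLdiv_nonneg_and_pos F.μ ν β (hM β) (hN β) hm hn
  choose pt hpt using fun α => nonempty_of_measure_ne_zero (hμP α).ne'
  have hθ : ∀ β, 0 < θv β := fun β => hθv β _ (hpt β) ▸ F.hθ_pos _
  have hterm : ∀ β, 0 ≤ F.KLdiv F.μ ν β * F.μ.real (F.P β) * θv β := fun β =>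
    mul_nonneg (mul_nonneg (hKL β).1 (hM β).le) (hθ β).le
  by_cases heq : ∀ p ∈ F.idx, F.μ.real (F.atom1 p.1 p.2) / F.μ.real (F.P (F.βm p.1 p.2)) =
      ν.real (F.atom1 p.1 p.2) / ν.real (F.P (F.βm p.1 p.2))
  · refine absurd ?_ hne
    have hψ : ∀ α, ∀ x ∈ F.P α, ψ x = ψ (pt α) := fun α x hx => hψconst α x hx _ (hpt α)
    have hiff := fun ν' => F.isConformalOnAtoms_iff (ν := ν') (c := fun α => ψ (pt α)) hψ
    have hc := (hiff ν).2 hνconf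
    have huniq : ∀ ν' : Measure X, IsProbabilityMeasure ν' →
        F.IsConformalOnAtoms ν' (fun α => ψ (pt α)) → ν' = ν :=
      fun ν' h1 h2 => hνuniq ν' h1 ((hiff ν').1 h2)
    have hA : ν F.A ≠ 0 := by
      refine fun h => (hνP1 α₀ 0 (F.hq_pos α₀)).ne' (measure_mono_null ?_ h)
      rw [F.atom1_eq, Function.iterate_zero, Set.image_id]
      exact Set.inter_subset_left
    have hscale : ∀ α, ∑ j ∈ Finset.range (F.q α), ψ (pt (F.βm α j)) = ψ (pt α) := fun α => by
      have hy := F.hRinv_A (pt α)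
      have hyα : F.R (F.Rinv (pt α)) ∈ F.P α := (F.hR_Rinv _).symm ▸ hpt α
      have h := hψscale _ hy
      rw [F.hR_Rinv, F.hq_ret α _ hy hyα] at h
      rw [← h]
      exact Finset.sum_congr rfl fun j hj =>
        (hψ _ _ (F.hβm α j (Finset.mem_range.1 hj) _ hy hyα)).symm
    have hzero := F.weights_eq_zero hμinv hc hA hμP hN
      (fun α => hc.measure_preimage_R hA hscale huniq (F.hP_meas α)) hα₀ hT heq
    exact huniq F.μ F.hμ_prob (hzero ▸ F.isConformalOnAtoms_zero hμinv)
  · push Not at heq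
    obtain ⟨p, hp, hpne⟩ := heq
    rw [hHu, lt_add_iff_pos_right]
    exact Finset.sum_pos' (fun β _ => hterm β) ⟨F.βm p.1 p.2, Finset.mem_univ _,
      mul_pos (mul_pos ((hKL _).2 ⟨p, hp, rfl, hpne⟩) (hM _)) (hθ _)⟩
end

section
/- In the conformal renormalization framework, suppose the incidence matrix M of the rescaling R, defined by M_{αβ} = #{ 0 ≤ j < q_α : β(α,j) = β } for α, β ∈ 𝒜, has all entries strictly positive, and suppose that max_{J∈𝒫^{(n)}} μ(J) → 0 and max_{J∈𝒫^{(n)}} diam(J) → 0 as n → ∞. Then the renormalization map R_μ : (X^θ, μ^θ) → (X^θ, μ^θ) is ergodic, i.e. every Borel set B ⊆ X^θ with μ^θ(B △ R_μ⁻¹B) = 0 satisfies μ^θ(B) ∈ {0, 1}. -/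
open MeasureTheory Filter
open scoped ENNReal

namespace CRF

section Renormalization

variable {X : Type*} [MetricSpace X] [CompactSpace X] [MeasurableSpace X] [BorelSpace X]
variable {𝒜 : Type*} [Fintype 𝒜] (F : CRF X 𝒜)

instance isProbabilityMeasure_μ : IsProbabilityMeasure F.μ := F.hμ_prob

/-- The last point of `A` visited by the backward orbit of `x`. -/
def base (x : X) : X := F.Tinv^[F.nA x] x

/-- The base map `x ↦ R (T⁻ⁱ x)` of the renormalization map. -/
def baseMap (x : X) : X := F.R (F.base x)

/-- The slope of the renormalization map on the fibre over `x`. -/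
noncomputable def slope (x : X) : ℝ :=
  Real.exp (-F.ρμ) * Real.exp (F.birk (F.nA x) (F.base x))

/-- The height to which the renormalization map sends the bottom of the fibre over `x`. -/
noncomputable def offset (x : X) : ℝ :=
  Real.exp (-F.ρμ) * F.birkθ (F.nA x) (F.base x)

/-- The proportion of the fibre over `baseMap x` filled by the image of the fibre over `x`. -/
noncomputable def ratio (x : X) : ℝ := F.slope x * F.θ x / F.θ (F.baseMap x)

lemma Rμ_apply (x : X) (r : ℝ) :
    F.Rμ (x, r) = (F.baseMap x, F.slope x * r + F.offset x) := by
  simp only [Rμ, baseMap, base, slope, offset]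
  congr 1
  ring

/-! ### First-return combinatorics -/

lemma Tinv_iterate_T_iterate {k i : ℕ} (h : k ≤ i) (y : X) :
    F.Tinv^[k] (F.T^[i] y) = F.T^[i - k] y := by
  obtain ⟨j, rfl⟩ := Nat.exists_eq_add_of_le h
  rw [Function.iterate_add_apply, F.hT_left.iterate k]
  simp

lemma nA_T_iterate_eq_iff (i : ℕ) (y : X) :
    F.nA (F.T^[i] y) = i ↔ y ∈ F.A ∧ i < F.rA y := by
  constructor
  · intro h
    have hy : y ∈ F.A := by
      have := F.hnA_mem (F.T^[i] y)
      rwa [h, F.Tinv_iterate_T_iterate le_rfl, Nat.sub_self] at this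
    refine ⟨hy, ?_⟩
    by_contra! hle
    have hpos := F.hrA_pos y hy
    refine F.hnA_min (F.T^[i] y) (i - F.rA y) (by omega) ?_
    rw [F.Tinv_iterate_T_iterate (by omega), Nat.sub_sub_self hle]
    exact F.hrA_mem y hy
  · rintro ⟨hy, hi⟩
    rcases lt_trichotomy (F.nA (F.T^[i] y)) i with h | h | h
    · have := F.hnA_mem (F.T^[i] y)
      rw [F.Tinv_iterate_T_iterate h.le] at this
      exact absurd this (F.hrA_min y hy _ (by omega) (by omega))
    · exact h
    · refine absurd ?_ (F.hnA_min _ i h)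
      rw [F.Tinv_iterate_T_iterate le_rfl, Nat.sub_self]
      exact hy

lemma T_iterate_base (x : X) : F.T^[F.nA x] (F.base x) = x :=
  F.hT_right.iterate (F.nA x) x

lemma base_mem (x : X) : F.base x ∈ F.A := F.hnA_mem x

lemma nA_lt_rA (x : X) : F.nA x < F.rA (F.base x) :=
  ((F.nA_T_iterate_eq_iff (F.nA x) (F.base x)).1 (by rw [T_iterate_base])).2

lemma nA_T_iterate {y : X} (hy : y ∈ F.A) {i : ℕ} (hi : i < F.rA y) : F.nA (F.T^[i] y) = i :=
  (F.nA_T_iterate_eq_iff i y).2 ⟨hy, hi⟩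

lemma base_T_iterate {y : X} (hy : y ∈ F.A) {i : ℕ} (hi : i < F.rA y) :
    F.base (F.T^[i] y) = y := by
  rw [base, F.nA_T_iterate hy hi, F.Tinv_iterate_T_iterate le_rfl, Nat.sub_self]
  rfl

lemma baseMap_of_mem {x : X} (hx : x ∈ F.A) : F.baseMap x = F.R x := by
  rw [baseMap, show F.base x = x from F.base_T_iterate hx (i := 0) (F.hrA_pos x hx)]

lemma baseMap_T_of_notMem {x : X} (hx : F.T x ∉ F.A) : F.baseMap (F.T x) = F.baseMap x := by
  have hT : F.T x = F.T^[F.nA x + 1] (F.base x) := by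
    rw [Function.iterate_succ_apply', T_iterate_base]
  have hlt : F.nA x + 1 < F.rA (F.base x) := by
    refine lt_of_le_of_ne (F.nA_lt_rA x) fun h => hx ?_
    rw [hT, h]
    exact F.hrA_mem _ (F.base_mem x)
  rw [baseMap, hT, F.base_T_iterate (F.base_mem x) hlt, baseMap]

lemma baseMap_T_of_mem {x : X} (hx : F.T x ∈ F.A) : F.baseMap (F.T x) = F.T (F.baseMap x) := by
  have hT : F.T x = F.T^[F.nA x + 1] (F.base x) := by
    rw [Function.iterate_succ_apply', T_iterate_base]
  have heq : F.nA x + 1 = F.rA (F.base x) := by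
    refine le_antisymm (F.nA_lt_rA x) (not_lt.1 fun h => ?_)
    exact F.hrA_min _ (F.base_mem x) _ (by omega) h (hT ▸ hx)
  rw [F.baseMap_of_mem hx, baseMap, F.hTR _ (F.base_mem x), ← heq, ← hT]

/-! ### Measurability -/

lemma measurable_birk (n : ℕ) : Measurable (F.birk n) := by
  unfold birk
  exact Finset.measurable_sum _ fun i _ => F.hφ_meas.comp (F.hT_meas.iterate i)

lemma measurable_birkθ (n : ℕ) : Measurable (F.birkθ n) := by
  unfold birkθ
  exact Finset.measurable_sum _ fun i _ =>
    (F.measurable_birk i).exp.mul (F.hθ_meas.comp (F.hT_meas.iterate i))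

lemma measurable_nA : Measurable F.nA := by
  refine measurable_to_countable' fun n => ?_
  have : F.nA ⁻¹' {n} = F.Tinv^[n] ⁻¹' F.A ∩ ⋂ k ∈ Set.Iio n, (F.Tinv^[k] ⁻¹' F.A)ᶜ := by
    ext x
    simp only [Set.mem_preimage, Set.mem_singleton_iff, Set.mem_inter_iff, Set.mem_iInter,
      Set.mem_Iio, Set.mem_compl_iff]
    constructor
    · rintro rfl
      exact ⟨F.hnA_mem x, F.hnA_min x⟩
    · rintro ⟨h1, h2⟩
      rcases lt_trichotomy (F.nA x) n with h | h | h
      · exact absurd (F.hnA_mem x) (h2 _ h)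
      · exact h
      · exact absurd h1 (F.hnA_min x n h)
  rw [this]
  exact (F.hTinv_meas.iterate n F.hA_meas).inter (MeasurableSet.biInter (Set.to_countable _)
    fun k _ => (F.hTinv_meas.iterate k F.hA_meas).compl)

lemma measurable_of_nA {β : Type*} [MeasurableSpace β] {g : ℕ → X → β}
    (hg : ∀ n, Measurable (g n)) {k : X → X} (hk : Measurable k) :
    Measurable fun x => g (F.nA x) (k x) := by
  have : Measurable fun p : ℕ × X => g p.1 p.2 := measurable_from_prod_countable_right hg
  exact this.comp (F.measurable_nA.prodMk hk)

lemma measurable_base : Measurable F.base :=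
  F.measurable_of_nA (g := fun n => F.Tinv^[n]) (fun n => F.hTinv_meas.iterate n) measurable_id

lemma measurable_baseMap : Measurable F.baseMap := F.hR_meas.comp F.measurable_base

lemma measurable_slope : Measurable F.slope :=
  (F.measurable_of_nA F.measurable_birk F.measurable_base).exp.const_mul _

lemma measurable_offset : Measurable F.offset :=
  (F.measurable_of_nA F.measurable_birkθ F.measurable_base).const_mul _

lemma measurable_ratio : Measurable F.ratio :=
  (F.measurable_slope.mul F.hθ_meas).div (F.hθ_meas.comp F.measurable_baseMap)

lemma measurable_Rμ : Measurable F.Rμ := by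
  have : F.Rμ = fun p => (F.baseMap p.1, F.slope p.1 * p.2 + F.offset p.1) := by
    ext1 p
    exact F.Rμ_apply p.1 p.2
  rw [this]
  exact (F.measurable_baseMap.comp measurable_fst).prodMk
    (((F.measurable_slope.comp measurable_fst).mul measurable_snd).add
      (F.measurable_offset.comp measurable_fst))

lemma measurableSet_Xθ : MeasurableSet F.Xθ :=
  (measurableSet_le measurable_const measurable_snd).inter
    (measurableSet_lt measurable_snd (F.hθ_meas.comp measurable_fst))

/-! ### Heights of images of fibres -/

lemma exp_neg_ρμ : Real.exp (-F.ρμ) = (F.μ F.A).toReal := by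
  rw [ρμ, neg_neg, Real.exp_log (ENNReal.toReal_pos F.hμA_pos.ne' (measure_ne_top _ _))]

lemma birkθ_succ (n : ℕ) (x : X) :
    F.birkθ (n + 1) x = F.birkθ n x + Real.exp (F.birk n x) * F.θ (F.T^[n] x) :=
  Finset.sum_range_succ _ _

lemma strictMono_birkθ (x : X) : StrictMono fun n => F.birkθ n x :=
  strictMono_nat_of_lt_succ fun n => by
    rw [birkθ_succ]
    exact lt_add_of_pos_right _ (mul_pos (Real.exp_pos _) (F.hθ_pos _))

lemma birkθ_zero (x : X) : F.birkθ 0 x = 0 := rfl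

lemma exp_mul_birkθ_rA {y : X} (hy : y ∈ F.A) :
    Real.exp (-F.ρμ) * F.birkθ (F.rA y) y = F.θ (F.R y) := by
  have h : F.birkθ (F.rA y) y = Real.exp F.ρμ * F.θ (F.R y) := F.hθA y hy
  rw [h, ← mul_assoc, ← Real.exp_add]
  simp

lemma slope_pos (x : X) : 0 < F.slope x := by unfold slope; positivity

lemma offset_nonneg (x : X) : 0 ≤ F.offset x :=
  mul_nonneg (Real.exp_pos _).le
    ((F.birkθ_zero (F.base x)).symm.le.trans ((F.strictMono_birkθ _).monotone (Nat.zero_le _)))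

lemma offset_pos_of_notMem {x : X} (hx : x ∉ F.A) : 0 < F.offset x := by
  refine mul_pos (Real.exp_pos _) ?_
  rw [← F.birkθ_zero (F.base x)]
  refine F.strictMono_birkθ _ (Nat.pos_of_ne_zero fun h => hx ?_)
  have := F.hnA_mem x
  rwa [h] at this

lemma slope_mul_add_offset (x : X) :
    F.slope x * F.θ x + F.offset x = Real.exp (-F.ρμ) * F.birkθ (F.nA x + 1) (F.base x) := by
  rw [birkθ_succ, T_iterate_base, slope, offset]
  ring

lemma slope_mul_add_offset_le (x : X) :
    F.slope x * F.θ x + F.offset x ≤ F.θ (F.baseMap x) := by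
  rw [slope_mul_add_offset, baseMap, ← F.exp_mul_birkθ_rA (F.base_mem x)]
  exact mul_le_mul_of_nonneg_left ((F.strictMono_birkθ _).monotone (F.nA_lt_rA x))
    (Real.exp_pos _).le

lemma ratio_pos (x : X) : 0 < F.ratio x :=
  div_pos (mul_pos (F.slope_pos x) (F.hθ_pos x)) (F.hθ_pos _)

lemma ratio_le_one (x : X) : F.ratio x ≤ 1 := by
  rw [ratio, div_le_one (F.hθ_pos _)]
  linarith [F.slope_mul_add_offset_le x, F.offset_nonneg x]

lemma mem_of_ratio_eq_one {x : X} (h : F.ratio x = 1) : x ∈ F.A := by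
  by_contra hx
  rw [ratio, div_eq_one_iff_eq (F.hθ_pos _).ne'] at h
  linarith [F.slope_mul_add_offset_le x, F.offset_pos_of_notMem hx]

/-! ### Conformality -/

lemma lintegral_T {g : X → ℝ≥0∞} (hg : Measurable g) :
    ∫⁻ x, g x ∂F.μ = ∫⁻ y, ENNReal.ofReal (Real.exp (F.φ y)) * g (F.T y) ∂F.μ := by
  have h1 : ∫⁻ x, g (F.T x) ∂(F.μ.map F.Tinv) = ∫⁻ x, g x ∂F.μ := by
    rw [lintegral_map (f := fun x => g (F.T x)) (hg.comp F.hT_meas) F.hTinv_meas]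
    exact lintegral_congr fun x => by rw [F.hT_right x]
  rw [← h1, F.hμ_conf, lintegral_withDensity_eq_lintegral_mul _ F.hφ_meas.exp.ennreal_ofReal
    (g := fun x => g (F.T x)) (hg.comp F.hT_meas)]
  rfl

lemma lintegral_T_iterate {g : X → ℝ≥0∞} (hg : Measurable g) (n : ℕ) :
    ∫⁻ x, g x ∂F.μ = ∫⁻ y, ENNReal.ofReal (Real.exp (F.birk n y)) * g (F.T^[n] y) ∂F.μ := by
  induction n with
  | zero => simp [birk]
  | succ n ih =>
    rw [ih, F.lintegral_T (g := fun y => ENNReal.ofReal (Real.exp (F.birk n y)) * g (F.T^[n] y))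
      ((F.measurable_birk n).exp.ennreal_ofReal.mul (hg.comp (F.hT_meas.iterate n)))]
    refine lintegral_congr fun y => ?_
    rw [← mul_assoc, ← ENNReal.ofReal_mul (Real.exp_pos _).le, ← Real.exp_add,
      ← Function.iterate_succ_apply]
    congr 3
    rw [birk, birk, Finset.sum_range_succ']
    simp [add_comm]

lemma lintegral_eq_setLIntegral_A {g : X → ℝ≥0∞} (hg : Measurable g) :
    ∫⁻ x, g x ∂F.μ = ∫⁻ y in F.A, ∑ i ∈ Finset.range (F.rA y),
      ENNReal.ofReal (Real.exp (F.birk i y)) * g (F.T^[i] y) ∂F.μ := by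
  have hm : ∀ i : ℕ, Measurable ((F.nA ⁻¹' {i}).indicator g) := fun i =>
    hg.indicator (F.measurable_nA (measurableSet_singleton i))
  calc ∫⁻ x, g x ∂F.μ = ∫⁻ x, ∑' i : ℕ, (F.nA ⁻¹' {i}).indicator g x ∂F.μ := by
        refine lintegral_congr fun x => ?_
        rw [tsum_eq_single (F.nA x) fun i hi => Set.indicator_of_notMem (by
          simpa using Ne.symm hi) _, Set.indicator_of_mem (by simp)]
    _ = ∑' i : ℕ, ∫⁻ x, (F.nA ⁻¹' {i}).indicator g x ∂F.μ :=
        lintegral_tsum fun i => (hm i).aemeasurable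
    _ = ∑' i : ℕ, ∫⁻ y, ENNReal.ofReal (Real.exp (F.birk i y)) *
          (F.nA ⁻¹' {i}).indicator g (F.T^[i] y) ∂F.μ :=
        tsum_congr fun i => F.lintegral_T_iterate (hm i) i
    _ = ∫⁻ y, ∑' i : ℕ, ENNReal.ofReal (Real.exp (F.birk i y)) *
          (F.nA ⁻¹' {i}).indicator g (F.T^[i] y) ∂F.μ :=
        (lintegral_tsum fun i => ((F.measurable_birk i).exp.ennreal_ofReal.mul
          ((hm i).comp (F.hT_meas.iterate i))).aemeasurable).symm
    _ = _ := by
        rw [← lintegral_indicator F.hA_meas]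
        refine lintegral_congr fun y => ?_
        by_cases hy : y ∈ F.A
        · rw [Set.indicator_of_mem hy, tsum_eq_sum (s := Finset.range (F.rA y))]
          · refine Finset.sum_congr rfl fun i hi => ?_
            rw [Set.indicator_of_mem]
            exact F.nA_T_iterate hy (Finset.mem_range.1 hi)
          · intro i hi
            rw [Set.indicator_of_notMem, mul_zero]
            exact fun h => hi (Finset.mem_range.2 ((F.nA_T_iterate_eq_iff i y).1 h).2)
        · rw [Set.indicator_of_notMem hy, ENNReal.tsum_eq_zero]
          intro i
          rw [Set.indicator_of_notMem, mul_zero]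
          exact fun h => hy ((F.nA_T_iterate_eq_iff i y).1 h).1

/-! ### Invariance of the suspension measure -/

lemma μθ_apply {S : Set (X × ℝ)} (hS : MeasurableSet S) :
    F.μθ S = ∫⁻ x, volume (Prod.mk x ⁻¹' S ∩ Set.Ico 0 (F.θ x)) ∂F.μ := by
  rw [μθ, Measure.restrict_apply hS, Measure.prod_apply (hS.inter F.measurableSet_Xθ)]
  rfl

lemma measurable_fibre_volume {S : Set (X × ℝ)} (hS : MeasurableSet S) :
    Measurable fun x => volume (Prod.mk x ⁻¹' S ∩ Set.Ico 0 (F.θ x)) :=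
  measurable_measure_prodMk_left (hS.inter F.measurableSet_Xθ)

lemma sum_volume_inter_Ico (E : Set ℝ) {c : ℕ → ℝ} (hc : Monotone c) (n : ℕ) :
    ∑ i ∈ Finset.range n, volume (E ∩ Set.Ico (c i) (c (i + 1))) =
      volume (E ∩ Set.Ico (c 0) (c n)) := by
  induction n with
  | zero => simp
  | succ n ih =>
    rw [Finset.sum_range_succ, ih, ← Set.Ico_union_Ico_eq_Ico (hc (Nat.zero_le n))
      (hc (Nat.le_succ n)), ← measure_inter_add_sdiff (E ∩ (_ ∪ _)) (measurableSet_Iio (a := c n))]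
    congr 2
    · ext t
      have := hc (Nat.zero_le n)
      simp only [Set.mem_inter_iff, Set.mem_Ico, Set.mem_union, Set.mem_Iio]
      grind
    · ext t
      have := hc (Nat.zero_le n)
      simp only [Set.mem_inter_iff, Set.mem_Ico, Set.mem_union, Set.mem_sdiff, Set.mem_Iio]
      grind

lemma volume_preimage_affine {a : ℝ} (ha : 0 < a) (b : ℝ) (E : Set ℝ) :
    ENNReal.ofReal a * volume ((fun r => a * r + b) ⁻¹' E) = volume E := by
  have : (fun r => a * r + b) ⁻¹' E = (fun r => a * r) ⁻¹' ((fun s => s + b) ⁻¹' E) := rfl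
  rw [this, Real.volume_preimage_mul_left ha.ne', measure_preimage_add_right, ← mul_assoc,
    ← ENNReal.ofReal_mul ha.le, abs_of_pos (inv_pos.2 ha), mul_inv_cancel₀ ha.ne']
  simp

lemma slope_mul_fibre_volume (S : Set (X × ℝ)) (x : X) :
    ENNReal.ofReal (F.slope x) *
        volume (Prod.mk x ⁻¹' (F.Rμ ⁻¹' S) ∩ Set.Ico 0 (F.θ x)) =
      volume (Prod.mk (F.baseMap x) ⁻¹' S ∩
        Set.Ico (F.offset x) (F.slope x * F.θ x + F.offset x)) := by
  rw [← volume_preimage_affine (F.slope_pos x) (F.offset x) (_ ∩ Set.Ico (F.offset x) _)]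
  congr 2
  ext r
  have h := F.slope_pos x
  simp only [Set.mem_inter_iff, Set.mem_preimage, Rμ_apply, Set.mem_Ico, le_add_iff_nonneg_left,
    add_lt_add_iff_right, mul_lt_mul_iff_right₀ h, mul_nonneg_iff_of_pos_left h]

lemma measurePreserving_Rμ : MeasurePreserving F.Rμ F.μθ F.μθ := by
  refine ⟨F.measurable_Rμ, Measure.ext fun S hS => ?_⟩
  rw [Measure.map_apply F.measurable_Rμ hS, F.μθ_apply (F.measurable_Rμ hS), F.μθ_apply hS,
    F.lintegral_eq_setLIntegral_A (F.measurable_fibre_volume (F.measurable_Rμ hS))]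
  set H : X → ℝ≥0∞ := fun x => volume (Prod.mk x ⁻¹' S ∩ Set.Ico 0 (F.θ x)) with hH
  have hA0 : F.μ F.A ≠ 0 := F.hμA_pos.ne'
  have hAtop : F.μ F.A ≠ ⊤ := measure_ne_top _ _
  have key : ∀ y ∈ F.A, ∑ i ∈ Finset.range (F.rA y), ENNReal.ofReal (Real.exp (F.birk i y)) *
      volume (Prod.mk (F.T^[i] y) ⁻¹' (F.Rμ ⁻¹' S) ∩ Set.Ico 0 (F.θ (F.T^[i] y))) =
        (F.μ F.A)⁻¹ * H (F.R y) := by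
    intro y hy
    have hmono : Monotone fun n => Real.exp (-F.ρμ) * F.birkθ n y := fun i j hij =>
      mul_le_mul_of_nonneg_left ((F.strictMono_birkθ y).monotone hij) (Real.exp_pos _).le
    have hsum := sum_volume_inter_Ico (Prod.mk (F.R y) ⁻¹' S) hmono (F.rA y)
    simp only [F.exp_mul_birkθ_rA hy, birkθ_zero, mul_zero] at hsum
    rw [hH]
    simp only
    rw [← hsum, Finset.mul_sum]
    refine Finset.sum_congr rfl fun i hi => ?_
    have hi' := Finset.mem_range.1 hi
    have h := F.slope_mul_fibre_volume S (F.T^[i] y)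
    rw [slope_mul_add_offset, slope, offset, baseMap, F.nA_T_iterate hy hi',
      F.base_T_iterate hy hi', ENNReal.ofReal_mul (Real.exp_pos _).le, mul_assoc,
      exp_neg_ρμ, ENNReal.ofReal_toReal hAtop] at h
    rw [exp_neg_ρμ, ← h, ← mul_assoc, ENNReal.inv_mul_cancel hA0 hAtop, one_mul]
  rw [setLIntegral_congr_fun F.hA_meas key,
    lintegral_const_mul' _ _ (ENNReal.inv_ne_top.2 hA0),
    ← lintegral_map (F.measurable_fibre_volume hS) F.hR_meas, F.hR_push, lintegral_smul_measure,
    smul_eq_mul, ← mul_assoc, ENNReal.inv_mul_cancel hA0 hAtop, one_mul]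

/-! ### Ergodicity of the base map -/

/-- The projection of the suspension measure to the base. -/
noncomputable def baseMeasure : Measure X := F.μθ.map Prod.fst

lemma baseMeasure_apply {E : Set X} (hE : MeasurableSet E) :
    F.baseMeasure E = F.μθ (Prod.fst ⁻¹' E) :=
  Measure.map_apply measurable_fst hE

lemma μθ_fst_preimage {E : Set X} (hE : MeasurableSet E) :
    F.μθ (Prod.fst ⁻¹' E) = ∫⁻ x in E, ENNReal.ofReal (F.θ x) ∂F.μ := by
  rw [F.μθ_apply (measurable_fst hE), ← lintegral_indicator hE]
  refine lintegral_congr fun x => ?_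
  by_cases hx : x ∈ E
  · have : Prod.mk x ⁻¹' (Prod.fst ⁻¹' E) = (Set.univ : Set ℝ) := by ext; simpa
    rw [Set.indicator_of_mem hx, this, Set.univ_inter, Real.volume_Ico, sub_zero]
  · have : Prod.mk x ⁻¹' (Prod.fst ⁻¹' E) = (∅ : Set ℝ) := by ext; simpa
    rw [Set.indicator_of_notMem hx, this, Set.empty_inter, measure_empty]

lemma baseMeasure_eq_zero_iff {E : Set X} (hE : MeasurableSet E) :
    F.baseMeasure E = 0 ↔ F.μ E = 0 := by
  rw [F.baseMeasure_apply hE, F.μθ_fst_preimage hE,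
    setLIntegral_eq_zero_iff hE F.hθ_meas.ennreal_ofReal]
  rw [ae_iff]
  simp [F.hθ_pos]

instance isProbabilityMeasure_μθ : IsProbabilityMeasure F.μθ := by
  refine ⟨?_⟩
  rw [← Set.preimage_univ (f := Prod.fst), F.μθ_fst_preimage MeasurableSet.univ,
    Measure.restrict_univ, ← ofReal_integral_eq_lintegral_ofReal
      (Integrable.of_integral_ne_zero (by rw [F.hθ_int]; exact one_ne_zero))
      (ae_of_all _ fun x => (F.hθ_pos x).le), F.hθ_int, ENNReal.ofReal_one]

instance isProbabilityMeasure_baseMeasure : IsProbabilityMeasure F.baseMeasure :=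
  Measure.isProbabilityMeasure_map measurable_fst.aemeasurable

lemma fst_Rμ (p : X × ℝ) : (F.Rμ p).1 = F.baseMap p.1 := rfl

lemma measurePreserving_baseMap : MeasurePreserving F.baseMap F.baseMeasure F.baseMeasure := by
  refine ⟨F.measurable_baseMap, ?_⟩
  rw [baseMeasure, Measure.map_map F.measurable_baseMap measurable_fst]
  conv_rhs => rw [← F.measurePreserving_Rμ.map_eq,
    Measure.map_map measurable_fst F.measurable_Rμ]
  rfl

lemma measure_A_inter_R_preimage {E : Set X} (hE : MeasurableSet E) :
    F.μ (F.R ⁻¹' E ∩ F.A) = F.μ F.A * F.μ E := by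
  rw [← Measure.restrict_apply (F.hR_meas hE), ← Measure.map_apply F.hR_meas hE, F.hR_push]
  rfl

lemma measure_eq_zero_of_subset_R_preimage {E : Set X} (hE : MeasurableSet E)
    (h : E ⊆ F.R ⁻¹' E ∩ F.A) : F.μ E = 0 := by
  by_contra h0
  have hle : F.μ E ≤ F.μ F.A * F.μ E := by
    rw [← F.measure_A_inter_R_preimage hE]
    exact measure_mono h
  have hlt : F.μ F.A * F.μ E < 1 * F.μ E :=
    (ENNReal.mul_lt_mul_iff_left h0 (measure_ne_top _ _)).2 F.hμA_lt
  rw [one_mul] at hlt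
  exact absurd hle (not_le.2 hlt)

lemma measure_eq_zero_of_Tinv_preimage {E : Set X} (hE : MeasurableSet E)
    (h : F.μ (F.Tinv ⁻¹' E) = 0) : F.μ E = 0 := by
  rw [← Measure.map_apply F.hTinv_meas hE, F.hμ_conf, withDensity_apply _ hE,
    setLIntegral_eq_zero_iff hE F.hφ_meas.exp.ennreal_ofReal, ae_iff] at h
  simpa [Real.exp_pos] using h

lemma measure_symmDiff_T_preimage {W : Set X} (hW : MeasurableSet W)
    (hinv : F.baseMap ⁻¹' W = W) : F.μ (symmDiff W (F.T ⁻¹' W)) = 0 := by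
  have hD : MeasurableSet (symmDiff W (F.T ⁻¹' W)) := hW.symmDiff (F.hT_meas hW)
  refine F.measure_eq_zero_of_Tinv_preimage hD ?_
  refine F.measure_eq_zero_of_subset_R_preimage (F.hTinv_meas hD) fun x hx => ?_
  have hW' : ∀ z, F.baseMap z ∈ W ↔ z ∈ W := fun z => by
    rw [← Set.mem_preimage, hinv]
  obtain ⟨z, rfl⟩ := F.hT_right.surjective x
  simp only [Set.mem_preimage, F.hT_left z, Set.mem_symmDiff] at hx
  have hA : F.T z ∈ F.A := by
    by_contra hA
    have := F.baseMap_T_of_notMem hA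
    have h1 := hW' z
    have h2 := hW' (F.T z)
    rw [this] at h2
    tauto
  refine ⟨?_, hA⟩
  have h1 := hW' z
  have h2 := hW' (F.T z)
  rw [F.baseMap_T_of_mem hA] at h2
  rw [Set.mem_preimage, Set.mem_preimage, ← F.baseMap_of_mem hA, F.baseMap_T_of_mem hA,
    F.hT_left, Set.mem_symmDiff, Set.mem_preimage]
  tauto

lemma ergodic_baseMap (hμerg : ∀ B : Set X, MeasurableSet B →
      F.μ (symmDiff B (F.T ⁻¹' B)) = 0 → F.μ B = 0 ∨ F.μ B = 1) :
    Ergodic F.baseMap F.baseMeasure := by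
  refine ⟨F.measurePreserving_baseMap, ⟨fun W hW hinv => ?_⟩⟩
  rw [eventuallyConst_set']
  rcases hμerg W hW (F.measure_symmDiff_T_preimage hW hinv) with h | h
  · exact Or.inl (ae_eq_empty.2 ((F.baseMeasure_eq_zero_iff hW).2 h))
  · right
    rw [ae_eq_univ, F.baseMeasure_eq_zero_iff hW.compl]
    exact (prob_compl_eq_zero_iff hW).2 h

/-! ### Contraction of the fibres -/

lemma prod_ratio_nonneg (n : ℕ) (x : X) :
    0 ≤ ∏ k ∈ Finset.range n, F.ratio (F.baseMap^[k] x) :=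
  Finset.prod_nonneg fun _ _ => (F.ratio_pos _).le

lemma antitone_prod_ratio (x : X) :
    Antitone fun n => ∏ k ∈ Finset.range n, F.ratio (F.baseMap^[k] x) :=
  antitone_nat_of_succ_le fun _ => by
    rw [Finset.prod_range_succ]
    exact mul_le_of_le_one_right (F.prod_ratio_nonneg _ x) (F.ratio_le_one _)

/-- The limiting proportion of the fibre filled by the iterated image of the fibre over `x`. -/
noncomputable def limRatio (x : X) : ℝ :=
  ⨅ n, ∏ k ∈ Finset.range n, F.ratio (F.baseMap^[k] x)

lemma tendsto_limRatio (x : X) :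
    Tendsto (fun n => ∏ k ∈ Finset.range n, F.ratio (F.baseMap^[k] x)) atTop
      (nhds (F.limRatio x)) :=
  tendsto_atTop_ciInf (F.antitone_prod_ratio x)
    ⟨0, by rintro _ ⟨n, rfl⟩; exact F.prod_ratio_nonneg n x⟩

lemma measurable_limRatio : Measurable F.limRatio :=
  Measurable.iInf fun _ => Finset.measurable_prod _ fun k _ =>
    F.measurable_ratio.comp (F.measurable_baseMap.iterate k)

lemma limRatio_nonneg (x : X) : 0 ≤ F.limRatio x :=
  ge_of_tendsto' (F.tendsto_limRatio x) fun n => F.prod_ratio_nonneg n x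

lemma limRatio_le_one (x : X) : F.limRatio x ≤ 1 :=
  le_of_tendsto' (F.tendsto_limRatio x) fun _ =>
    Finset.prod_le_one (fun _ _ => (F.ratio_pos _).le) fun _ _ => F.ratio_le_one _

lemma limRatio_eq (x : X) : F.limRatio x = F.ratio x * F.limRatio (F.baseMap x) := by
  have h1 := (F.tendsto_limRatio x).comp (tendsto_add_atTop_nat 1)
  have h2 := (F.tendsto_limRatio (F.baseMap x)).const_mul (F.ratio x)
  refine tendsto_nhds_unique h1 (h2.congr fun n => ?_)
  simp only [Function.comp, Finset.prod_range_succ', Function.iterate_succ_apply,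
    Function.iterate_zero, id]
  ring

lemma integrable_limRatio : Integrable F.limRatio F.baseMeasure :=
  Integrable.of_bound F.measurable_limRatio.aestronglyMeasurable 1 (ae_of_all _ fun x => by
    rw [Real.norm_of_nonneg (F.limRatio_nonneg x)]
    exact F.limRatio_le_one x)

lemma limRatio_ae_eq_comp :
    F.limRatio =ᵐ[F.baseMeasure] F.limRatio ∘ F.baseMap := by
  have hmp := F.measurePreserving_baseMap
  have hint : Integrable (F.limRatio ∘ F.baseMap) F.baseMeasure :=
    (hmp.integrable_comp F.measurable_limRatio.aestronglyMeasurable).2 F.integrable_limRatio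
  refine (integral_eq_iff_of_ae_le F.integrable_limRatio hint (ae_of_all _ fun x => ?_)).1 ?_
  · rw [limRatio_eq]
    exact mul_le_of_le_one_left (F.limRatio_nonneg _) (F.ratio_le_one x)
  · have := integral_map (μ := F.baseMeasure) hmp.measurable.aemeasurable
      F.measurable_limRatio.aestronglyMeasurable
    rw [hmp.map_eq] at this
    exact this

lemma limRatio_ae_eq_zero (herg : Ergodic F.baseMap F.baseMeasure) :
    ∀ᵐ x ∂F.baseMeasure, F.limRatio x = 0 := by
  have hS : MeasurableSet {x | F.limRatio x = 0} :=
    F.measurable_limRatio (measurableSet_singleton 0)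
  have hinv : F.baseMap ⁻¹' {x | F.limRatio x = 0} = {x | F.limRatio x = 0} := by
    ext x
    simp [F.limRatio_eq x, (F.ratio_pos x).ne']
  rcases eventuallyConst_set.1 (herg.aeconst_set hS hinv) with h | h
  · exact h
  · exfalso
    have hA : ∀ᵐ x ∂F.baseMeasure, x ∈ F.A := by
      filter_upwards [h, F.limRatio_ae_eq_comp] with x hx0 hx
      refine F.mem_of_ratio_eq_one ?_
      have h1 := F.limRatio_eq x
      rw [Function.comp_apply] at hx
      rw [← hx] at h1
      exact mul_right_cancel₀ hx0 (by rw [← h1, one_mul])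
    have h0 : F.μ F.Aᶜ = 0 := (F.baseMeasure_eq_zero_iff F.hA_meas.compl).1 (ae_iff.1 hA)
    exact F.hμA_lt.ne ((prob_compl_eq_zero_iff F.hA_meas).1 h0)

lemma fst_Rμ_iterate (n : ℕ) (p : X × ℝ) : (F.Rμ^[n] p).1 = F.baseMap^[n] p.1 := by
  induction n with
  | zero => rfl
  | succ n ih => rw [Function.iterate_succ_apply', Function.iterate_succ_apply', fst_Rμ, ih]

lemma snd_Rμ (p : X × ℝ) : (F.Rμ p).2 = F.slope p.1 * p.2 + F.offset p.1 :=
  congrArg Prod.snd (F.Rμ_apply p.1 p.2)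

lemma snd_Rμ_iterate_sub (n : ℕ) (x : X) (r : ℝ) :
    ((F.Rμ^[n] (x, r)).2 - (F.Rμ^[n] (x, 0)).2) * F.θ x =
      r * ((∏ k ∈ Finset.range n, F.ratio (F.baseMap^[k] x)) * F.θ (F.baseMap^[n] x)) := by
  induction n with
  | zero => simp
  | succ n ih =>
    rw [Function.iterate_succ_apply', Function.iterate_succ_apply', snd_Rμ, snd_Rμ,
      fst_Rμ_iterate, fst_Rμ_iterate, Finset.prod_range_succ, Function.iterate_succ_apply' F.baseMap,
      ratio]
    have h0 := (F.hθ_pos (F.baseMap (F.baseMap^[n] x))).ne'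
    field_simp
    linear_combination (F.slope (F.baseMap^[n] x)) * ih

lemma dist_Rμ_iterate_le {C : ℝ} (hC : ∀ x, F.θ x ≤ C) (n : ℕ) {x : X} {r : ℝ}
    (hr : (x, r) ∈ F.Xθ) :
    dist (F.Rμ^[n] (x, r)) (F.Rμ^[n] (x, 0)) ≤
      (∏ k ∈ Finset.range n, F.ratio (F.baseMap^[k] x)) * C := by
  have hθ := F.hθ_pos x
  obtain ⟨hr0, hrθ⟩ : 0 ≤ r ∧ r < F.θ x := hr
  have hp := F.prod_ratio_nonneg n x
  set p := ∏ k ∈ Finset.range n, F.ratio (F.baseMap^[k] x) with hpdef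
  have hC' := hC (F.baseMap^[n] x)
  have hpos := F.hθ_pos (F.baseMap^[n] x)
  have hpC : 0 ≤ p * C := mul_nonneg hp (hpos.le.trans hC')
  rw [Prod.dist_eq, fst_Rμ_iterate, fst_Rμ_iterate, dist_self, Real.dist_eq]
  refine max_le hpC (le_of_mul_le_mul_right ?_ hθ)
  rw [← abs_of_pos hθ, ← abs_mul, snd_Rμ_iterate_sub, ← hpdef, abs_of_pos hθ,
    abs_of_nonneg (mul_nonneg hr0 (mul_nonneg hp hpos.le)), mul_comm]
  exact mul_le_mul (mul_le_mul_of_nonneg_left hC' hp) hrθ.le hr0 hpC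

/-! ### Invariant sets are unions of fibres -/

lemma exists_symmDiff_fst_preimage_le (herg : Ergodic F.baseMap F.baseMeasure) {C : ℝ}
    (hC : ∀ x, F.θ x ≤ C) {B : Set (X × ℝ)} (hB : MeasurableSet B)
    (hinv : F.Rμ ⁻¹' B =ᵐ[F.μθ] B) {ε : ℝ≥0∞} (hε : ε ≠ 0) :
    ∃ W : Set X, MeasurableSet W ∧ F.μθ (symmDiff B (Prod.fst ⁻¹' W)) ≤ ε := by
  have hε3 : ε / 3 ≠ 0 := (ENNReal.div_pos hε (by norm_num)).ne'
  obtain ⟨K, hKB, hK, hKε⟩ := hB.exists_isCompact_sdiff_lt (measure_ne_top F.μθ B) hε3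
  obtain ⟨L, hLB, hL, hLε⟩ := hB.compl.exists_isCompact_sdiff_lt (measure_ne_top F.μθ Bᶜ) hε3
  have hKL : Disjoint K L := Set.disjoint_of_subset hKB hLB disjoint_compl_right
  obtain ⟨δ, hδ, hdisj⟩ := hKL.exists_thickenings hK hL.isClosed
  have htend : ∀ᵐ x ∂F.baseMeasure, Tendsto (fun n =>
      (∏ k ∈ Finset.range n, F.ratio (F.baseMap^[k] x)) * C) atTop (nhds 0) := by
    filter_upwards [F.limRatio_ae_eq_zero herg] with x hx
    have := (F.tendsto_limRatio x).mul_const C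
    rwa [hx, zero_mul] at this
  have hmeas : ∀ n : ℕ, Measurable fun x =>
      (∏ k ∈ Finset.range n, F.ratio (F.baseMap^[k] x)) * C := fun n =>
    (Finset.measurable_prod _ fun k _ =>
      F.measurable_ratio.comp (F.measurable_baseMap.iterate k)).mul_const C
  obtain ⟨n, hn⟩ : ∃ n : ℕ, F.baseMeasure
      {x | δ ≤ (∏ k ∈ Finset.range n, F.ratio (F.baseMap^[k] x)) * C} ≤ ε / 3 := by
    have h1 := tendstoInMeasure_of_tendsto_ae (fun n => (hmeas n).aestronglyMeasurable) htend
    have h2 := h1 (ENNReal.ofReal δ) (by simpa using hδ)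
    have h3 := (h2.eventually (ge_mem_nhds (pos_iff_ne_zero.2 hε3))).exists
    obtain ⟨n, hn⟩ := h3
    refine ⟨n, (measure_mono fun x hx => ?_).trans hn⟩
    have hx' : δ ≤ (∏ k ∈ Finset.range n, F.ratio (F.baseMap^[k] x)) * C := hx
    simp only [Set.mem_ofPred_eq, edist_dist, Real.dist_eq, sub_zero]
    exact ENNReal.ofReal_le_ofReal (hx'.trans (le_abs_self _))
  set Z : Set X := {x | δ ≤ (∏ k ∈ Finset.range n, F.ratio (F.baseMap^[k] x)) * C} with hZ
  have hZm : MeasurableSet Z := measurableSet_le measurable_const (hmeas n)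
  have hRn : MeasurePreserving F.Rμ^[n] F.μθ F.μθ := F.measurePreserving_Rμ.iterate n
  let W : Set X := {x | F.Rμ^[n] (x, 0) ∈ Metric.thickening δ K}
  have hW : MeasurableSet W :=
    (hRn.measurable.comp (measurable_id.prodMk measurable_const))
      Metric.isOpen_thickening.measurableSet
  refine ⟨W, hW, ?_⟩
  have hBn : F.Rμ^[n] ⁻¹' B =ᵐ[F.μθ] B :=
    F.measurePreserving_Rμ.quasiMeasurePreserving.preimage_iterate_ae_eq n hinv
  have hX : ∀ᵐ p ∂F.μθ, p ∈ F.Xθ := ae_restrict_mem F.measurableSet_Xθ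
  have hsub : symmDiff B (Prod.fst ⁻¹' W) ≤ᵐ[F.μθ]
      (Prod.fst ⁻¹' Z ∪ F.Rμ^[n] ⁻¹' (B \ K) ∪ F.Rμ^[n] ⁻¹' (Bᶜ \ L) : Set (X × ℝ)) := by
    filter_upwards [hBn.mem_iff, hX] with p hp hpX hpB
    by_contra hcon
    change p ∉ (Prod.fst ⁻¹' Z ∪ F.Rμ^[n] ⁻¹' (B \ K) ∪ F.Rμ^[n] ⁻¹' (Bᶜ \ L) : Set (X × ℝ)) at hcon
    simp only [Set.mem_union, Set.mem_preimage, Set.mem_sdiff, Set.mem_compl_iff, not_or,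
      not_and, not_not] at hcon
    obtain ⟨⟨hpZ, hpK⟩, hpL⟩ := hcon
    have hd : dist (F.Rμ^[n] (p.1, 0)) (F.Rμ^[n] p) < δ := by
      rw [dist_comm]
      exact (F.dist_Rμ_iterate_le hC n hpX).trans_lt (not_le.1 hpZ)
    rw [Set.mem_preimage] at hp
    rcases hpB with ⟨h1, h2⟩ | ⟨h1, h2⟩
    · exact h2 (Metric.mem_thickening_iff.2 ⟨_, hpK (hp.2 h1), hd⟩)
    · exact Set.disjoint_left.1 hdisj h1
        (Metric.mem_thickening_iff.2 ⟨_, hpL (fun h => h2 (hp.1 h)), hd⟩)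
  calc F.μθ (symmDiff B (Prod.fst ⁻¹' W))
      ≤ F.μθ (Prod.fst ⁻¹' Z ∪ F.Rμ^[n] ⁻¹' (B \ K) ∪ F.Rμ^[n] ⁻¹' (Bᶜ \ L)) :=
        measure_mono_ae hsub
    _ ≤ F.μθ (Prod.fst ⁻¹' Z) + F.μθ (F.Rμ^[n] ⁻¹' (B \ K)) +
          F.μθ (F.Rμ^[n] ⁻¹' (Bᶜ \ L)) :=
        (measure_union_le _ _).trans (add_le_add_left (measure_union_le _ _) _)
    _ ≤ ε / 3 + ε / 3 + ε / 3 := by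
        rw [hRn.measure_preimage (hB.diff hK.measurableSet).nullMeasurableSet,
          hRn.measure_preimage (hB.compl.diff hL.measurableSet).nullMeasurableSet,
          ← F.baseMeasure_apply hZm]
        exact add_le_add (add_le_add hn hKε.le) hLε.le
    _ = ε := ENNReal.add_thirds ε

open Classical in
lemma μθ_symmDiff_fst_preimage {B : Set (X × ℝ)} (hB : MeasurableSet B) {W : Set X}
    (hW : MeasurableSet W) :
    F.μθ (symmDiff B (Prod.fst ⁻¹' W)) =
      ∫⁻ x, if x ∈ W then volume (Prod.mk x ⁻¹' Bᶜ ∩ Set.Ico 0 (F.θ x))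
        else volume (Prod.mk x ⁻¹' B ∩ Set.Ico 0 (F.θ x)) ∂F.μ := by
  rw [F.μθ_apply (hB.symmDiff (measurable_fst hW))]
  refine lintegral_congr fun x => ?_
  split_ifs with hx <;> congr 2 <;> ext r <;> simp [Set.mem_symmDiff, hx]

lemma exists_ae_eq_fst_preimage {B : Set (X × ℝ)} (hB : MeasurableSet B)
    (happrox : ∀ ε : ℝ≥0∞, ε ≠ 0 → ∃ W : Set X, MeasurableSet W ∧
      F.μθ (symmDiff B (Prod.fst ⁻¹' W)) ≤ ε) :
    ∃ W : Set X, MeasurableSet W ∧ B =ᵐ[F.μθ] Prod.fst ⁻¹' W := by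
  classical
  set u : X → ℝ≥0∞ := fun x => volume (Prod.mk x ⁻¹' B ∩ Set.Ico 0 (F.θ x)) with hu
  set w : X → ℝ≥0∞ := fun x => volume (Prod.mk x ⁻¹' Bᶜ ∩ Set.Ico 0 (F.θ x)) with hw
  have hum : Measurable u := F.measurable_fibre_volume hB
  have hwm : Measurable w := F.measurable_fibre_volume hB.compl
  have hmin : ∫⁻ x, min (u x) (w x) ∂F.μ = 0 := by
    by_contra h0
    obtain ⟨W, hW, hle⟩ := happrox _ (ENNReal.half_pos h0).ne'
    have hfin : ∫⁻ x, min (u x) (w x) ∂F.μ ≠ ⊤ := by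
      refine ne_top_of_le_ne_top (measure_ne_top F.μθ B) ?_
      rw [F.μθ_apply hB]
      exact lintegral_mono fun x => min_le_left _ _
    refine absurd (hle.trans_lt (ENNReal.half_lt_self h0 hfin)) (not_lt.2 ?_)
    rw [F.μθ_symmDiff_fst_preimage hB hW]
    refine lintegral_mono fun x => ?_
    dsimp only
    split_ifs
    · exact min_le_right _ _
    · exact min_le_left _ _
  rw [lintegral_eq_zero_iff (hum.min hwm)] at hmin
  have hW : MeasurableSet {x | w x = 0} := hwm (measurableSet_singleton 0)
  refine ⟨{x | w x = 0}, hW, ?_⟩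
  rw [← measure_symmDiff_eq_zero_iff, F.μθ_symmDiff_fst_preimage hB hW]
  refine (lintegral_congr_ae ?_).trans lintegral_zero
  filter_upwards [hmin] with x hx
  split_ifs with h
  · exact h
  · exact (min_eq_bot.1 hx).resolve_right h

lemma RμErgodic_of_ergodic (herg : Ergodic F.baseMap F.baseMeasure) {C : ℝ}
    (hC : ∀ x, F.θ x ≤ C) : F.RμErgodic := by
  intro B hB hinv
  have hinv' : F.Rμ ⁻¹' B =ᵐ[F.μθ] B := (measure_symmDiff_eq_zero_iff.1 hinv).symm
  obtain ⟨W, hW, hBW⟩ := F.exists_ae_eq_fst_preimage hB fun ε hε =>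
    F.exists_symmDiff_fst_preimage_le herg hC hB hinv' hε
  have hpre : F.Rμ ⁻¹' B =ᵐ[F.μθ] F.Rμ ⁻¹' (Prod.fst ⁻¹' W) :=
    F.measurePreserving_Rμ.quasiMeasurePreserving.preimage_ae_eq hBW
  have hWW : (Prod.fst ⁻¹' (F.baseMap ⁻¹' W) : Set (X × ℝ)) =ᵐ[F.μθ] Prod.fst ⁻¹' W :=
    hpre.symm.trans (hinv'.trans hBW)
  have hWinv : F.baseMap ⁻¹' W =ᵐ[F.baseMeasure] W := by
    rw [← measure_symmDiff_eq_zero_iff,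
      F.baseMeasure_apply ((F.measurable_baseMap hW).symmDiff hW)]
    exact measure_symmDiff_eq_zero_iff.2 hWW
  rw [measure_congr hBW, ← F.baseMeasure_apply hW]
  exact herg.quasiErgodic.ae_empty_or_univ₀ hW.nullMeasurableSet hWinv |>.imp
    (fun h => by rw [measure_congr h, measure_empty])
    (fun h => by rw [measure_congr h, measure_univ])

end Renormalization

end CRF

/-- Ergodicity of the renormalization map: in the conformal renormalization framework,
with `μ` the unique `φ`-conformal probability measure, ergodic for `T`, and `θ`
constant on the atoms of `𝒫`, if the incidence matrix
`M_{αβ} = #{0 ≤ j < q_α : β(α,j) = β}` has strictly positive entries and both the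
`μ`-measures and the diameters of the atoms of `𝒫^{(n)}` tend to `0` uniformly, then
`R_μ : (X^θ, μ^θ) → (X^θ, μ^θ)` is ergodic. -/
theorem renormalization_ergodic
    {X : Type*} [MetricSpace X] [CompactSpace X] [MeasurableSpace X] [BorelSpace X]
    {𝒜 : Type*} [Fintype 𝒜] [DecidableEq 𝒜]
    (F : CRF X 𝒜)
    (hμuniq : ∀ μ' : Measure X, IsProbabilityMeasure μ' →
      μ'.map F.Tinv = μ'.withDensity (fun x => ENNReal.ofReal (Real.exp (F.φ x))) →
        μ' = F.μ)
    (hμerg : ∀ B : Set X, MeasurableSet B →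
      F.μ (symmDiff B (F.T ⁻¹' B)) = 0 → F.μ B = 0 ∨ F.μ B = 1)
    (θv : 𝒜 → ℝ) (hθv : ∀ β : 𝒜, ∀ x ∈ F.P β, F.θ x = θv β)
    (hM : ∀ α β : 𝒜,
      0 < ((Finset.range (F.q α)).filter fun j => F.βm α j = β).card)
    (hμdiam : ∀ ε > (0 : ℝ), ∃ N : ℕ, ∀ n ≥ N, ∀ x : X,
      F.μ (F.Pn n x) < ENNReal.ofReal ε ∧ Metric.diam (F.Pn n x) < ε) :
    F.RμErgodic := by
  have hC : ∀ x, F.θ x ≤ ∑ α, |θv α| := fun x => by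
    obtain ⟨α, hα⟩ := Set.mem_iUnion.1 (F.hP_cover.symm ▸ Set.mem_univ x)
    rw [hθv α x hα]
    exact (le_abs_self _).trans
      (Finset.single_le_sum (f := fun α => |θv α|) (fun _ _ => abs_nonneg _) (Finset.mem_univ α))
  exact F.RμErgodic_of_ergodic (F.ergodic_baseMap hμerg) hC
end
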